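/- There exists a constant C > 0 (depending only on the distribution of ξ) such that for all integers k ≥ 1 and n ≥ 1 (with P(|𝒯| = n) > 0), E Q_k(T̂_n) ≤ C k, where T̂_n is the subtree of the conditioned Galton–Watson tree T_n consisting of a uniformly random vertex of T_n together with all its descendants. -/

import Mathlib

open scoped ENNReal BigOperators
open Set Filter

/-- Plane (ordered rooted) trees. -/
inductive PlaneTree : Type
  | node : List PlaneTree → PlaneTree

namespace PlaneTree

/-- The list of subtrees hanging off the root. -/
def children : PlaneTree → List PlaneTree
  | .node ts => ts

/-- The subtree rooted at a given position (sequence of child indices), if it exists. -/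
def subtreeAt : PlaneTree → List ℕ → Option PlaneTree
  | t, [] => some t
  | .node ts, i :: q =>
    match ts[i]? with
    | some t' => subtreeAt t' q
    | none => none

/-- The vertex set of a tree, with vertices identified with their positions. -/
def vertexSet (t : PlaneTree) : Set (List ℕ) := {q | (subtreeAt t q).isSome}

/-- The number of vertices of a tree. -/
noncomputable def size (t : PlaneTree) : ℕ := (vertexSet t).ncard

/-- The number of children of the vertex at position `q`. -/
def childCount (t : PlaneTree) (q : List ℕ) : ℕ :=
  ((subtreeAt t q).map fun t' => t'.children.length).getD 0

end PlaneTree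

/-- Longest common prefix of two positions; this is the position of the last common
ancestor of the two vertices. -/
def lca : List ℕ → List ℕ → List ℕ
  | a :: as, b :: bs => if a = b then a :: lca as bs else []
  | _, _ => []

/-- The distance from `v` up to the last common ancestor of `v` and `w`. -/
def dUp (v w : List ℕ) : ℕ := v.length - (lca v w).length

/-- The graph distance between the vertices at positions `v` and `w`. -/
def treeDist (v w : List ℕ) : ℕ := dUp v w + dUp w v

/-- The Galton–Watson probability of a given finite tree: the product, over all vertices,
of the probability that the offspring distribution takes the value given by the number of
children of the vertex. -/
noncomputable def gwProb (p : ℕ → ℝ≥0∞) (t : PlaneTree) : ℝ≥0∞ :=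
  ∏ᶠ v ∈ PlaneTree.vertexSet t, p (PlaneTree.childCount t v)

/-- `P(|𝒯| = n)` for the Galton–Watson tree `𝒯`. -/
noncomputable def probSize (p : ℕ → ℝ≥0∞) (n : ℕ) : ℝ≥0∞ :=
  ∑' t : PlaneTree, if PlaneTree.size t = n then gwProb p t else 0

/-- `E f(T_n)` where `T_n` is the Galton–Watson tree conditioned to have `n` vertices. -/
noncomputable def condExp (p : ℕ → ℝ≥0∞) (n : ℕ) (f : PlaneTree → ℝ≥0∞) : ℝ≥0∞ :=
  (∑' t : PlaneTree, if PlaneTree.size t = n then gwProb p t * f t else 0) / probSize p n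

/-- The variance of the offspring distribution `p` (which has mean `1`). -/
noncomputable def xiVar (p : ℕ → ℝ≥0∞) : ℝ≥0∞ :=
  ∑' k : ℕ, p k * ENNReal.ofReal (((k : ℝ) - 1) ^ 2)

/-- `P_k(t)`: the number of unordered pairs of vertices of `t` at graph distance `k`. -/
noncomputable def pairCount (t : PlaneTree) (k : ℕ) : ℕ :=
  {s : Set (List ℕ) | ∃ v w, v ∈ PlaneTree.vertexSet t ∧ w ∈ PlaneTree.vertexSet t ∧
    s = {v, w} ∧ treeDist v w = k}.ncard

/-- The number of unordered pairs of vertices of `t` at graph distance `k` from each other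
whose last common ancestor is the vertex at position `u` (equivalently, the pairs of
vertices of the subtree rooted at `u` whose connecting path passes through `u`; one of the
two vertices may be `u` itself). -/
noncomputable def pairCountThrough (t : PlaneTree) (u : List ℕ) (k : ℕ) : ℕ :=
  {s : Set (List ℕ) | ∃ v w, v ∈ PlaneTree.vertexSet t ∧ w ∈ PlaneTree.vertexSet t ∧
    s = {v, w} ∧ treeDist v w = k ∧ lca v w = u}.ncard

/-- `Q_k(t)`: the number of unordered pairs of vertices of `t` at graph distance `k`
whose connecting path passes through the root of `t`. -/
noncomputable def rootPairCount (t : PlaneTree) (k : ℕ) : ℕ := pairCountThrough t [] k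

namespace PlaneTree

theorem nil_mem_vertexSet (t : PlaneTree) : [] ∈ vertexSet t := by
  simp [vertexSet, subtreeAt]

theorem subtreeAt_node_cons (ts : List PlaneTree) (i : Fin ts.length) (q : List ℕ) :
    subtreeAt (node ts) ((i : ℕ) :: q) = subtreeAt (ts.get i) q := by
  simp [subtreeAt]

theorem cons_mem_vertexSet_node {ts : List PlaneTree} {i : ℕ} {q : List ℕ} :
    i :: q ∈ vertexSet (node ts) ↔ ∃ h : i < ts.length, q ∈ vertexSet (ts.get ⟨i, h⟩) := by
  constructor
  · intro h
    by_cases hi : i < ts.length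
    · refine ⟨hi, ?_⟩
      have := subtreeAt_node_cons ts ⟨i, hi⟩ q
      simp only [vertexSet, mem_ofPred_eq] at h ⊢
      rwa [← this]
    · simp [vertexSet, subtreeAt, List.getElem?_eq_none (not_lt.1 hi)] at h
  · rintro ⟨hi, h⟩
    have := subtreeAt_node_cons ts ⟨i, hi⟩ q
    simp only [vertexSet, mem_ofPred_eq] at h ⊢
    rwa [this]

theorem vertexSet_node (ts : List PlaneTree) :
    vertexSet (node ts) =
      insert [] (⋃ i : Fin ts.length, List.cons (i : ℕ) '' vertexSet (ts.get i)) := by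
  ext q
  rcases q with _ | ⟨i, q⟩
  · simp [nil_mem_vertexSet]
  · rw [cons_mem_vertexSet_node]
    simp only [mem_insert_iff, reduceCtorEq, mem_iUnion, mem_image, List.cons.injEq, false_or]
    constructor
    · rintro ⟨h, hq⟩
      exact ⟨⟨i, h⟩, q, hq, rfl, rfl⟩
    · rintro ⟨j, r, hr, rfl, rfl⟩
      exact ⟨j.2, hr⟩

theorem finite_vertexSet : ∀ t : PlaneTree, (vertexSet t).Finite
  | node ts => by
    rw [vertexSet_node]
    refine (Set.finite_iUnion fun i => ?_).insert _
    have : sizeOf (ts.get i) < sizeOf ts := List.sizeOf_lt_of_mem (List.get_mem ts i)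
    exact (finite_vertexSet (ts.get i)).image _
termination_by t => sizeOf t
decreasing_by simp only [PlaneTree.node.sizeOf_spec]; omega

@[to_additive]
theorem finprod_mem_vertexSet_node {M : Type*} [CommMonoid M] (ts : List PlaneTree)
    (F : List ℕ → M) :
    ∏ᶠ v ∈ vertexSet (node ts), F v =
      F [] * ∏ i : Fin ts.length, ∏ᶠ v ∈ vertexSet (ts.get i), F ((i : ℕ) :: v) := by
  have hfin : ∀ i : Fin ts.length, (List.cons (i : ℕ) '' vertexSet (ts.get i)).Finite :=
    fun i => (finite_vertexSet _).image _
  rw [vertexSet_node, finprod_mem_insert _ (by simp) (Set.finite_iUnion hfin),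
    finprod_mem_iUnion _ hfin, finprod_eq_prod_of_fintype]
  · congr 1
    refine Finset.prod_congr rfl fun i _ => ?_
    rw [finprod_mem_image (fun _ _ _ _ h => (List.cons.inj h).2)]
  · intro i j hij
    rw [Function.onFun, Set.disjoint_left]
    rintro _ ⟨q, _, rfl⟩ ⟨r, _, hr⟩
    exact hij (Fin.ext (List.cons.inj hr).1.symm)

@[to_additive]
theorem prod_fin_get {M : Type*} [CommMonoid M] (ts : List PlaneTree) (g : PlaneTree → M) :
    ∏ i : Fin ts.length, g (ts.get i) = (ts.map g).prod := by
  rw [← List.prod_ofFn]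
  congr 1
  exact List.ofFn_getElem_eq_map ts g

theorem size_eq_finsum (t : PlaneTree) : size t = ∑ᶠ _v ∈ vertexSet t, 1 := by
  rw [size, finsum_mem_eq_finite_toFinset_sum _ (finite_vertexSet t),
    Set.ncard_eq_toFinset_card _ (finite_vertexSet t)]
  simp

theorem size_node (ts : List PlaneTree) : size (node ts) = (ts.map size).sum + 1 := by
  rw [size_eq_finsum, finsum_mem_vertexSet_node, ← sum_fin_get]
  simp only [← size_eq_finsum]
  ring

theorem gwProb_node (p : ℕ → ℝ≥0∞) (ts : List PlaneTree) :
    gwProb p (node ts) = p ts.length * (ts.map (gwProb p)).prod := by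
  rw [gwProb, finprod_mem_vertexSet_node, ← prod_fin_get]
  congr 1
  refine Finset.prod_congr rfl fun i _ => ?_
  simp only [gwProb, childCount, subtreeAt_node_cons]

/-- The vertices of `t` at distance `k` from the root. -/
noncomputable def level (t : PlaneTree) (k : ℕ) : Finset (List ℕ) :=
  (finite_vertexSet t).toFinset.filter fun v => v.length = k

theorem mem_level {t : PlaneTree} {k : ℕ} {v : List ℕ} :
    v ∈ level t k ↔ v ∈ vertexSet t ∧ v.length = k := by
  simp [level]

theorem card_level_eq_finsum (t : PlaneTree) (k : ℕ) :
    (level t k).card = ∑ᶠ v ∈ vertexSet t, if v.length = k then 1 else 0 := by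
  rw [finsum_mem_eq_finite_toFinset_sum _ (finite_vertexSet t), level, Finset.card_filter]

theorem card_level_zero (t : PlaneTree) : (level t 0).card = 1 := by
  rw [Finset.card_eq_one]
  refine ⟨[], ?_⟩
  ext v
  simp only [mem_level, List.length_eq_zero_iff, Finset.mem_singleton, and_iff_right_iff_imp]
  rintro rfl
  exact nil_mem_vertexSet t

theorem card_level_succ (ts : List PlaneTree) (k : ℕ) :
    (level (node ts) (k + 1)).card = (ts.map fun t => (level t k).card).sum := by
  rw [card_level_eq_finsum, finsum_mem_vertexSet_node, ← sum_fin_get]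
  simp [card_level_eq_finsum]

/-- The sum of `f` over all fringe subtrees of `t`. -/
noncomputable def fringeSum (f : PlaneTree → ℝ≥0∞) (t : PlaneTree) : ℝ≥0∞ :=
  ∑ᶠ u ∈ vertexSet t, (subtreeAt t u).elim 0 f

theorem fringeSum_node (f : PlaneTree → ℝ≥0∞) (ts : List PlaneTree) :
    fringeSum f (node ts) = f (node ts) + (ts.map (fringeSum f)).sum := by
  rw [fringeSum, finsum_mem_vertexSet_node, ← sum_fin_get]
  simp only [subtreeAt_node_cons, fringeSum]
  rfl

theorem fringeSum_one (t : PlaneTree) : fringeSum (fun _ => 1) t = size t := by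
  rw [fringeSum, finsum_mem_eq_finite_toFinset_sum _ (finite_vertexSet t), size,
    Set.ncard_eq_toFinset_card _ (finite_vertexSet t), Finset.card_eq_sum_ones, Nat.cast_sum]
  refine Finset.sum_congr rfl fun u hu => ?_
  rw [Set.Finite.mem_toFinset] at hu
  obtain ⟨s, hs⟩ := Option.isSome_iff_exists.1 hu
  simp [hs]

theorem finite_pairs (t : PlaneTree) (R : List ℕ → List ℕ → Prop) :
    {s : Set (List ℕ) | ∃ v w, v ∈ vertexSet t ∧ w ∈ vertexSet t ∧
      s = {v, w} ∧ R v w}.Finite := by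
  refine (((finite_vertexSet t).prod (finite_vertexSet t)).image
    fun x : List ℕ × List ℕ => ({x.1, x.2} : Set (List ℕ))).subset ?_
  rintro _ ⟨v, w, hv, hw, rfl, _⟩
  exact ⟨(v, w), ⟨hv, hw⟩, rfl⟩

theorem lca_eq_cons {v w u : List ℕ} {i : ℕ} (h : lca v w = i :: u) :
    ∃ v' w', v = i :: v' ∧ w = i :: w' ∧ lca v' w' = u := by
  rcases v with _ | ⟨a, v⟩
  · simp [lca] at h
  rcases w with _ | ⟨b, w⟩
  · simp [lca] at h
  by_cases hab : a = b
  · subst hab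
    simp only [lca, if_true, List.cons.injEq] at h
    exact ⟨v, w, by rw [h.1], by rw [h.1], h.2⟩
  · simp [lca, hab] at h

theorem treeDist_cons_cons (i : ℕ) (v w : List ℕ) : treeDist (i :: v) (i :: w) = treeDist v w := by
  simp [treeDist, dUp, lca]

theorem pairCountThrough_node_cons_le (ts : List PlaneTree) (i : Fin ts.length) (u : List ℕ)
    (k : ℕ) : pairCountThrough (node ts) ((i : ℕ) :: u) k ≤ pairCountThrough (ts.get i) u k := by
  have hfin := finite_pairs (ts.get i) fun v w => treeDist v w = k ∧ lca v w = u
  refine le_trans (Set.ncard_le_ncard (t := Set.image (List.cons (i : ℕ)) '' _) ?_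
    (hfin.image _)) (Set.ncard_image_le hfin)
  rintro _ ⟨v, w, hv, hw, rfl, hd, hl⟩
  obtain ⟨v', w', rfl, rfl, h⟩ := lca_eq_cons hl
  obtain ⟨_, hv⟩ := cons_mem_vertexSet_node.1 hv
  obtain ⟨_, hw⟩ := cons_mem_vertexSet_node.1 hw
  exact ⟨{v', w'}, ⟨v', w', hv, hw, rfl, by rwa [treeDist_cons_cons] at hd, h⟩, by
    rw [Set.image_pair]⟩

theorem pairCountThrough_le_rootPairCount {t s : PlaneTree} {u : List ℕ}
    (h : subtreeAt t u = some s) (k : ℕ) : pairCountThrough t u k ≤ rootPairCount s k := by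
  induction u generalizing t with
  | nil =>
    simp only [subtreeAt, Option.some.injEq] at h
    rw [h, rootPairCount]
  | cons i u ih =>
    obtain ⟨ts⟩ := t
    have hmem : i :: u ∈ vertexSet (node ts) := by simp [vertexSet, h]
    obtain ⟨hi, _⟩ := cons_mem_vertexSet_node.1 hmem
    rw [subtreeAt_node_cons ts ⟨i, hi⟩] at h
    exact (pairCountThrough_node_cons_le ts ⟨i, hi⟩ u k).trans (ih h)

theorem finsum_pairCountThrough_le_fringeSum {f : PlaneTree → ℝ≥0∞} {k : ℕ}
    (hf : ∀ t, (rootPairCount t k : ℝ≥0∞) ≤ f t) (t : PlaneTree) :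
    ∑ᶠ u ∈ vertexSet t, (pairCountThrough t u k : ℝ≥0∞) ≤ fringeSum f t := by
  rw [fringeSum, finsum_mem_eq_finite_toFinset_sum _ (finite_vertexSet t),
    finsum_mem_eq_finite_toFinset_sum _ (finite_vertexSet t)]
  refine Finset.sum_le_sum fun u hu => ?_
  rw [Set.Finite.mem_toFinset] at hu
  obtain ⟨s, hs⟩ := Option.isSome_iff_exists.1 hu
  rw [hs]
  exact le_trans (Nat.cast_le.2 (pairCountThrough_le_rootPairCount hs k)) (hf s)

theorem finsum_pairCountThrough_le_sq (t : PlaneTree) (k : ℕ) :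
    ∑ᶠ u ∈ vertexSet t, (pairCountThrough t u k : ℝ≥0∞) ≤ (size t : ℝ≥0∞) ^ 2 := by
  classical
  set V := (finite_vertexSet t).toFinset with hV
  have hcard : V.card = size t := (Set.ncard_eq_toFinset_card _ (finite_vertexSet t)).symm
  have hle : ∀ u, pairCountThrough t u k ≤ ((V ×ˢ V).filter fun x => lca x.1 x.2 = u).card := by
    intro u
    rw [pairCountThrough]
    refine le_trans (Set.ncard_le_ncard (t := ((((V ×ˢ V).filter fun x => lca x.1 x.2 = u).image
      fun x => ({x.1, x.2} : Set (List ℕ)) : Finset (Set (List ℕ))) : Set (Set (List ℕ)))) ?_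
      (Finset.finite_toSet _)) ?_
    · rintro _ ⟨v, w, hv, hw, rfl, hd, hl⟩
      simp only [Finset.coe_image, Finset.coe_filter, Set.mem_image]
      exact ⟨(v, w), by simp [hV, hv, hw, hl], rfl⟩
    · rw [Set.ncard_coe_finset]
      exact Finset.card_image_le
  rw [finsum_mem_eq_finite_toFinset_sum _ (finite_vertexSet t), ← Nat.cast_sum, ← hcard,
    ← Nat.cast_pow, Nat.cast_le]
  calc ∑ u ∈ V, pairCountThrough t u k
      ≤ ∑ u ∈ V, ((V ×ˢ V).filter fun x => lca x.1 x.2 = u).card :=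
        Finset.sum_le_sum fun u _ => hle u
    _ ≤ (V ×ˢ V).card := by
        rw [Finset.sum_card_fiberwise_eq_card_filter]
        exact Finset.card_filter_le _ _
    _ = V.card ^ 2 := by rw [Finset.card_product, sq]

/-- The sum of `g t * h t'` over the ordered pairs of entries of a list at distinct positions. -/
noncomputable def offDiagSum (g h : PlaneTree → ℝ≥0∞) : List PlaneTree → ℝ≥0∞
  | [] => 0
  | t :: ts => g t * (ts.map h).sum + h t * (ts.map g).sum + offDiagSum g h ts

theorem sum_offDiag_get (g h : PlaneTree → ℝ≥0∞) (ts : List PlaneTree) :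
    ∑ a : Fin ts.length, ∑ b : Fin ts.length,
      (if a = b then 0 else g (ts.get a) * h (ts.get b)) = offDiagSum g h ts := by
  induction ts with
  | nil => simp [offDiagSum]
  | cons t ts ih =>
    rw [offDiagSum, ← ih, ← sum_fin_get, ← sum_fin_get]
    simp only [List.length_cons, Fin.sum_univ_succ, List.get_cons_zero, List.get_cons_succ',
      if_true, zero_add, Fin.succ_inj, (Fin.succ_ne_zero _).symm, Fin.succ_ne_zero, if_false,
      Finset.sum_add_distrib, Finset.mul_sum]
    rw [add_assoc]
    simp only [mul_comm]
    exact add_left_comm _ _ _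

theorem rootPairCount_node_le (ts : List PlaneTree) (k : ℕ) :
    (rootPairCount (node ts) k : ℝ≥0∞) ≤ (level (node ts) k).card +
      ∑ i ∈ Finset.range (k - 1),
        offDiagSum (fun t => (level t i).card) (fun t => (level t (k - 2 - i)).card) ts := by
  classical
  let A : Finset (Set (List ℕ)) := (level (node ts) k).image fun w => {[], w}
  let B : ℕ → Fin ts.length → Fin ts.length → Finset (Set (List ℕ)) := fun i a b =>
    if a = b then ∅ else
    (level (ts.get a) i ×ˢ level (ts.get b) (k - 2 - i)).image
      fun x => {(a : ℕ) :: x.1, (b : ℕ) :: x.2}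
  let U : Finset (Set (List ℕ)) := A ∪ (Finset.range (k - 1)).biUnion fun i =>
    Finset.univ.biUnion fun a => Finset.univ.biUnion fun b => B i a b
  have hsub : rootPairCount (node ts) k ≤ U.card := by
    rw [rootPairCount, pairCountThrough, ← Set.ncard_coe_finset U]
    refine Set.ncard_le_ncard ?_ (Finset.finite_toSet _)
    rintro _ ⟨v, w, hv, hw, rfl, hd, hl⟩
    have hlen : v.length + w.length = k := by
      have hl' : lca w v = [] := by
        rcases v with _ | ⟨a, v⟩ <;> rcases w with _ | ⟨b, w⟩ <;> simp_all [lca, eq_comm]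
      simpa [treeDist, dUp, hl, hl'] using hd
    simp only [U, Finset.coe_union, Set.mem_union, Finset.mem_coe]
    rcases v with _ | ⟨a, v⟩
    · left
      refine Finset.mem_image.2 ⟨w, mem_level.2 ⟨hw, by simpa using hlen⟩, rfl⟩
    rcases w with _ | ⟨b, w⟩
    · left
      refine Finset.mem_image.2 ⟨a :: v, mem_level.2 ⟨hv, by simpa using hlen⟩, ?_⟩
      rw [Set.pair_comm]
    right
    have hab : a ≠ b := by
      rintro rfl
      simp [lca] at hl
    obtain ⟨ha, hv⟩ := cons_mem_vertexSet_node.1 hv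
    obtain ⟨hb, hw⟩ := cons_mem_vertexSet_node.1 hw
    simp only [List.length_cons] at hlen
    simp only [Finset.mem_biUnion, Finset.mem_univ, true_and, Finset.mem_range]
    refine ⟨v.length, by omega, ⟨a, ha⟩, ⟨b, hb⟩, ?_⟩
    simp only [B, Fin.mk.injEq, hab, if_false, Finset.mem_image, Finset.mem_product, mem_level]
    exact ⟨(v, w), ⟨⟨hv, rfl⟩, hw, by dsimp only; omega⟩, rfl⟩
  have hB : ∀ i, ((Finset.univ.biUnion fun a => Finset.univ.biUnion fun b => B i a b).card : ℝ≥0∞) ≤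
      offDiagSum (fun t => (level t i).card) (fun t => (level t (k - 2 - i)).card) ts := by
    intro i
    rw [← sum_offDiag_get]
    refine le_trans (Nat.cast_le.2 Finset.card_biUnion_le) ?_
    rw [Nat.cast_sum]
    refine Finset.sum_le_sum fun a _ => ?_
    refine le_trans (Nat.cast_le.2 Finset.card_biUnion_le) ?_
    rw [Nat.cast_sum]
    refine Finset.sum_le_sum fun b _ => ?_
    by_cases hab : a = b
    · simp [B, hab]
    · simp only [B, hab, if_false]
      refine le_trans (Nat.cast_le.2 Finset.card_image_le) ?_
      rw [Finset.card_product, Nat.cast_mul]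
  refine le_trans (Nat.cast_le.2 (hsub.trans (Finset.card_union_le _ _))) ?_
  rw [Nat.cast_add]
  refine add_le_add (Nat.cast_le.2 Finset.card_image_le) ?_
  refine le_trans (Nat.cast_le.2 Finset.card_biUnion_le) ?_
  rw [Nat.cast_sum]
  exact Finset.sum_le_sum fun i _ => hB i

end PlaneTree

namespace PlaneTree

open PowerSeries

/-- The generating function, by size, of the Galton–Watson trees weighted by `f`. -/
noncomputable def treeSeries (p : ℕ → ℝ≥0∞) (f : PlaneTree → ℝ≥0∞) : PowerSeries ℝ≥0∞ :=
  PowerSeries.mk fun n => ∑' t : PlaneTree, if size t = n then gwProb p t * f t else 0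

/-- The generating function, by total size, of forests of `j` independent Galton–Watson trees
weighted by `φ`. -/
noncomputable def forestSeries (p : ℕ → ℝ≥0∞) (j : ℕ) (φ : List PlaneTree → ℝ≥0∞) :
    PowerSeries ℝ≥0∞ :=
  PowerSeries.mk fun n => ∑' ts : List PlaneTree,
    if ts.length = j ∧ (ts.map size).sum = n then (ts.map (gwProb p)).prod * φ ts else 0

/-- The generating function of the size of a Galton–Watson tree. -/
noncomputable def sizeSeries (p : ℕ → ℝ≥0∞) : PowerSeries ℝ≥0∞ := treeSeries p fun _ => 1

/-- The composition of the power series with coefficients `c` with `sizeSeries p`. -/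
noncomputable def compSize (p c : ℕ → ℝ≥0∞) : PowerSeries ℝ≥0∞ :=
  PowerSeries.mk fun n => ∑' j, c j * coeff n (sizeSeries p ^ j)

theorem coeff_compSize_mul (p c : ℕ → ℝ≥0∞) (Z : PowerSeries ℝ≥0∞) (n : ℕ) :
    coeff n (compSize p c * Z) = ∑' j, c j * coeff n (sizeSeries p ^ j * Z) := by
  simp only [coeff_mul, compSize, coeff_mk, ← ENNReal.tsum_mul_right, Finset.mul_sum]
  rw [← Summable.tsum_finsetSum fun _ _ => ENNReal.summable]
  simp only [mul_assoc]

variable {p : ℕ → ℝ≥0∞}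

theorem forestSeries_add (j : ℕ) (φ ψ : List PlaneTree → ℝ≥0∞) :
    forestSeries p j (fun ts => φ ts + ψ ts) = forestSeries p j φ + forestSeries p j ψ := by
  ext n
  simp only [forestSeries, coeff_mk, map_add, ← ENNReal.tsum_add]
  refine tsum_congr fun ts => ?_
  split_ifs <;> simp [mul_add]

theorem treeSeries_add (f g : PlaneTree → ℝ≥0∞) :
    treeSeries p (fun t => f t + g t) = treeSeries p f + treeSeries p g := by
  ext n
  simp only [treeSeries, coeff_mk, map_add, ← ENNReal.tsum_add]
  refine tsum_congr fun t => ?_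
  split_ifs <;> simp [mul_add]

theorem treeSeries_sum {ι : Type*} (s : Finset ι) (f : ι → PlaneTree → ℝ≥0∞) :
    treeSeries p (fun t => ∑ i ∈ s, f i t) = ∑ i ∈ s, treeSeries p (f i) := by
  classical
  induction s using Finset.induction_on with
  | empty =>
    ext n
    simp [treeSeries]
  | insert a s ha ih =>
    simp only [Finset.sum_insert ha, treeSeries_add, ih]

theorem forestSeries_zero (φ : List PlaneTree → ℝ≥0∞) :
    forestSeries p 0 φ = C (φ []) := by
  ext n
  rw [forestSeries, coeff_mk, tsum_eq_single [], coeff_C]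
  · simp [eq_comm]
  · intro ts hts
    simp [hts]

theorem forestSeries_succ {j : ℕ} {φ ψ : List PlaneTree → ℝ≥0∞} {h : PlaneTree → ℝ≥0∞}
    (hφ : ∀ t ts, φ (t :: ts) = h t * ψ ts) :
    forestSeries p (j + 1) φ = treeSeries p h * forestSeries p j ψ := by
  ext n
  have hinj : Function.Injective fun x : PlaneTree × List PlaneTree => x.1 :: x.2 := by
    rintro ⟨t, ts⟩ ⟨t', ts'⟩ h
    simpa using h
  rw [forestSeries, coeff_mk, ← hinj.tsum_eq, coeff_mul]
  · simp only [treeSeries, forestSeries, coeff_mk, ← ENNReal.tsum_mul_right,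
      ← ENNReal.tsum_mul_left]
    rw [ENNReal.tsum_prod', ENNReal.tsum_comm,
      ← Summable.tsum_finsetSum fun _ _ => ENNReal.summable]
    refine tsum_congr fun ts => ?_
    rw [← Summable.tsum_finsetSum fun _ _ => ENNReal.summable]
    refine tsum_congr fun t => ?_
    simp only [List.length_cons, List.map_cons, List.sum_cons, List.prod_cons, hφ]
    by_cases hlen : ts.length = j
    · by_cases hn : size t + (ts.map size).sum = n
      · rw [Finset.sum_eq_single (size t, (ts.map size).sum)]
        · simp only [hlen, hn, and_self, if_true]
          ring
        · rintro ⟨a, b⟩ _ hne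
          by_cases ha : size t = a
          · have hb : ¬ (ts.map size).sum = b := fun hb => hne (by rw [ha, hb])
            simp [hb]
          · simp [ha]
        · intro hmem
          exact absurd (Finset.HasAntidiagonal.mem_antidiagonal.2 hn) hmem
      · rw [Finset.sum_eq_zero]
        · simp [hn]
        · rintro ⟨a, b⟩ hab
          rw [Finset.HasAntidiagonal.mem_antidiagonal] at hab
          by_cases ha : size t = a
          · have hb : ¬ (ts.map size).sum = b := fun hb => hn (by rw [ha, hb, hab])
            simp [hb]
          · simp [ha]
    · simp [hlen]
  · intro ts hts
    rcases ts with _ | ⟨t, ts⟩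
    · simp at hts
    · exact ⟨(t, ts), rfl⟩

theorem forestSeries_one (j : ℕ) : forestSeries p j (fun _ => 1) = sizeSeries p ^ j := by
  induction j with
  | zero => simp [forestSeries_zero]
  | succ j ih =>
    rw [forestSeries_succ (ψ := fun _ => 1) (h := fun _ => 1) (by simp), ih, pow_succ']
    rfl

theorem forestSeries_sum_zero (h : PlaneTree → ℝ≥0∞) :
    forestSeries p 0 (fun ts => (ts.map h).sum) = 0 := by
  simp [forestSeries_zero]

theorem forestSeries_cons_add {j : ℕ} {φ ψ χ : List PlaneTree → ℝ≥0∞} {h : PlaneTree → ℝ≥0∞}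
    (hφ : ∀ t ts, φ (t :: ts) = h t * ψ ts + χ ts) :
    forestSeries p (j + 1) φ =
      treeSeries p h * forestSeries p j ψ + sizeSeries p * forestSeries p j χ := by
  have h1 : forestSeries p (j + 1) (fun ts => h (ts.headD (node [])) * ψ ts.tail) =
      treeSeries p h * forestSeries p j ψ := forestSeries_succ (by simp)
  have h2 : forestSeries p (j + 1) (fun ts => 1 * χ ts.tail) =
      sizeSeries p * forestSeries p j χ := forestSeries_succ (h := fun _ => 1) (by simp)
  rw [← h1, ← h2, ← forestSeries_add]
  ext n
  simp only [forestSeries, coeff_mk]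
  refine tsum_congr fun ts => ?_
  rcases ts with _ | ⟨t, ts⟩
  · simp
  · simp [hφ]

theorem forestSeries_sum (h : PlaneTree → ℝ≥0∞) (j : ℕ) :
    forestSeries p (j + 1) (fun ts => (ts.map h).sum) =
      (j + 1 : ℕ) * (treeSeries p h * sizeSeries p ^ j) := by
  induction j with
  | zero =>
    rw [forestSeries_cons_add (h := h) (ψ := fun _ => 1) (χ := fun ts => (ts.map h).sum)
      (by simp), forestSeries_one, forestSeries_sum_zero]
    simp
  | succ j ih =>
    rw [forestSeries_cons_add (h := h) (ψ := fun _ => 1) (χ := fun ts => (ts.map h).sum)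
      (by simp), forestSeries_one, ih]
    push_cast
    ring

theorem forestSeries_offDiagSum_zero (g h : PlaneTree → ℝ≥0∞) :
    forestSeries p 0 (offDiagSum g h) = 0 := by
  simp [forestSeries_zero, offDiagSum]

theorem forestSeries_offDiagSum_succ (g h : PlaneTree → ℝ≥0∞) (j : ℕ) :
    forestSeries p (j + 1) (offDiagSum g h) =
      treeSeries p g * forestSeries p j (fun ts => (ts.map h).sum) +
      (treeSeries p h * forestSeries p j (fun ts => (ts.map g).sum) +
        sizeSeries p * forestSeries p j (offDiagSum g h)) := by
  have h1 : forestSeries p (j + 1)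
      (fun ts => g (ts.headD (node [])) * (ts.tail.map h).sum) =
      treeSeries p g * forestSeries p j (fun ts => (ts.map h).sum) := forestSeries_succ (by simp)
  have h2 : forestSeries p (j + 1)
      (fun ts => h (ts.headD (node [])) * (ts.tail.map g).sum + offDiagSum g h ts.tail) =
      treeSeries p h * forestSeries p j (fun ts => (ts.map g).sum) +
        sizeSeries p * forestSeries p j (offDiagSum g h) := forestSeries_cons_add (by simp)
  rw [← h1, ← h2, ← forestSeries_add]
  ext n
  simp only [forestSeries, coeff_mk]
  refine tsum_congr fun ts => ?_
  rcases ts with _ | ⟨t, ts⟩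
  · simp
  · simp [offDiagSum, add_assoc]

theorem forestSeries_offDiagSum_one (g h : PlaneTree → ℝ≥0∞) :
    forestSeries p 1 (offDiagSum g h) = 0 := by
  rw [← zero_add 1, forestSeries_offDiagSum_succ]
  simp [forestSeries_sum_zero, forestSeries_offDiagSum_zero]

theorem forestSeries_offDiagSum (g h : PlaneTree → ℝ≥0∞) (j : ℕ) :
    forestSeries p (j + 2) (offDiagSum g h) =
      ((j + 2) * (j + 1) : ℕ) * (treeSeries p g * treeSeries p h * sizeSeries p ^ j) := by
  induction j with
  | zero =>
    rw [forestSeries_offDiagSum_succ, forestSeries_sum, forestSeries_sum, zero_add,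
      forestSeries_offDiagSum_one]
    push_cast
    ring
  | succ j ih =>
    rw [forestSeries_offDiagSum_succ, forestSeries_sum, forestSeries_sum, ih]
    push_cast
    ring

theorem coeff_succ_treeSeries {f : PlaneTree → ℝ≥0∞} {φ : List PlaneTree → ℝ≥0∞}
    (hf : ∀ ts, f (node ts) = φ ts) (n : ℕ) :
    coeff (n + 1) (treeSeries p f) = ∑' j, p j * coeff n (forestSeries p j φ) := by
  let e : List PlaneTree ≃ PlaneTree := ⟨node, children, fun _ => rfl, fun t => by cases t; rfl⟩
  rw [treeSeries, coeff_mk, ← e.tsum_eq]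
  simp only [forestSeries, coeff_mk, ← ENNReal.tsum_mul_left]
  rw [ENNReal.tsum_comm]
  refine tsum_congr fun ts => ?_
  rw [tsum_eq_single ts.length]
  · change (if size (node ts) = n + 1 then gwProb p (node ts) * f (node ts) else 0) = _
    rw [size_node, gwProb_node, hf]
    simp only [add_left_inj, true_and]
    split_ifs <;> simp [mul_assoc]
  · intro j hj
    simp [hj.symm]

theorem coeff_zero_treeSeries (f : PlaneTree → ℝ≥0∞) : coeff 0 (treeSeries p f) = 0 := by
  rw [treeSeries, coeff_mk, ENNReal.tsum_eq_zero]
  rintro ⟨ts⟩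
  simp [size_node]

theorem sizeSeries_eq (p : ℕ → ℝ≥0∞) : sizeSeries p = X * compSize p p := by
  ext n
  rcases n with _ | n
  · simp [sizeSeries, coeff_zero_treeSeries]
  · rw [sizeSeries, coeff_succ_treeSeries (φ := fun _ => 1) (by simp), coeff_succ_X_mul]
    simp [compSize, forestSeries_one, sizeSeries]

theorem treeSeries_sum_children {f h : PlaneTree → ℝ≥0∞}
    (hf : ∀ ts, f (node ts) = (ts.map h).sum) :
    treeSeries p f = X * (compSize p (fun j => (j + 1 : ℕ) * p (j + 1)) * treeSeries p h) := by
  ext n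
  rcases n with _ | n
  · simp [coeff_zero_treeSeries]
  · rw [coeff_succ_treeSeries hf, coeff_succ_X_mul, coeff_compSize_mul,
      tsum_eq_zero_add' ENNReal.summable, forestSeries_sum_zero]
    simp only [forestSeries_sum, map_zero, mul_zero, zero_add]
    refine tsum_congr fun j => ?_
    rw [← nsmul_eq_mul, map_nsmul, nsmul_eq_mul, mul_comm (treeSeries p h)]
    ring

theorem treeSeries_offDiag_children {f g h : PlaneTree → ℝ≥0∞}
    (hf : ∀ ts, f (node ts) = offDiagSum g h ts) :
    treeSeries p f = X * (compSize p (fun j => ((j + 2) * (j + 1) : ℕ) * p (j + 2)) *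
      (treeSeries p g * treeSeries p h)) := by
  ext n
  rcases n with _ | n
  · simp [coeff_zero_treeSeries]
  · rw [coeff_succ_treeSeries hf, coeff_succ_X_mul, coeff_compSize_mul,
      tsum_eq_zero_add' ENNReal.summable, tsum_eq_zero_add' ENNReal.summable,
      forestSeries_offDiagSum_zero, zero_add, forestSeries_offDiagSum_one]
    simp only [forestSeries_offDiagSum, add_assoc, one_add_one_eq_two, map_zero, mul_zero,
      zero_add]
    refine tsum_congr fun j => ?_
    rw [← nsmul_eq_mul, map_nsmul, nsmul_eq_mul, mul_comm (_ * _) (sizeSeries p ^ j)]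
    ring

/-- The probability that the sum of `n` independent copies of the offspring variable is `s`. -/
noncomputable def sumProb (p : ℕ → ℝ≥0∞) (n s : ℕ) : ℝ≥0∞ := coeff s (PowerSeries.mk p ^ n)

/-- The generating function of the probabilities that `n` copies of the offspring variable
sum to `n`. -/
noncomputable def bridgeSeries (p : ℕ → ℝ≥0∞) : PowerSeries ℝ≥0∞ :=
  PowerSeries.mk fun n => sumProb p n n

theorem sumProb_succ (p : ℕ → ℝ≥0∞) (n s : ℕ) :
    sumProb p (n + 1) s = ∑ j ∈ Finset.range (s + 1), p j * sumProb p n (s - j) := by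
  rw [sumProb, pow_succ', coeff_mul, Finset.Nat.sum_antidiagonal_eq_sum_range_succ_mk]
  simp [sumProb]

theorem coeff_sizeSeries_pow_mul_bridgeSeries (n r : ℕ) :
    coeff n (sizeSeries p ^ r * bridgeSeries p) = if r ≤ n then sumProb p n (n - r) else 0 := by
  induction n generalizing r with
  | zero =>
    rcases r with _ | r
    · simp [bridgeSeries]
    · rw [pow_succ', mul_assoc, coeff_zero_eq_constantCoeff_apply, map_mul,
        ← coeff_zero_eq_constantCoeff_apply, sizeSeries, coeff_zero_treeSeries]
      simp
  | succ n ih =>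
    rcases r with _ | r
    · simp [bridgeSeries]
    · rw [pow_succ', mul_assoc]
      nth_rewrite 1 [sizeSeries_eq]
      rw [mul_assoc, coeff_succ_X_mul, coeff_compSize_mul]
      simp only [← mul_assoc, ← pow_add, ih, add_le_add_iff_right, Nat.add_sub_add_right]
      split_ifs with hr
      · rw [sumProb_succ, tsum_eq_sum (s := Finset.range (n - r + 1))]
        · refine Finset.sum_congr rfl fun j hj => ?_
          rw [Finset.mem_range] at hj
          rw [if_pos (by omega)]
          congr 2
          omega
        · intro j hj
          rw [Finset.mem_range] at hj
          rw [if_neg (by omega), mul_zero]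
      · rw [ENNReal.tsum_eq_zero]
        intro j
        rw [if_neg (by omega), mul_zero]

theorem succ_mul_sumProb_succ (p : ℕ → ℝ≥0∞) (n s : ℕ) :
    (s + 1 : ℝ≥0∞) * sumProb p (n + 1) (s + 1) =
      (n + 1) * ∑ j ∈ Finset.range (s + 1), ((j + 1 : ℕ) * p (j + 1)) * sumProb p n (s - j) := by
  have h := congrArg (coeff s) (PowerSeries.derivative_pow (PowerSeries.mk p) (n + 1))
  rw [coeff_derivative, Nat.add_sub_cancel, mul_assoc, ← nsmul_eq_mul, map_nsmul, nsmul_eq_mul,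
    mul_comm (_ ^ n), coeff_mul, Finset.Nat.sum_antidiagonal_eq_sum_range_succ_mk] at h
  rw [sumProb, mul_comm, h]
  push_cast
  congr 1
  refine Finset.sum_congr rfl fun j _ => ?_
  rw [coeff_derivative, coeff_mk, sumProb, mul_comm (p (j + 1))]

theorem bridgeSeries_eq (p : ℕ → ℝ≥0∞) :
    bridgeSeries p =
      1 + X * (compSize p (fun j => (j + 1 : ℕ) * p (j + 1)) * bridgeSeries p) := by
  ext n
  rcases n with _ | n
  · simp [bridgeSeries, sumProb]
  · rw [map_add, coeff_succ_X_mul, coeff_compSize_mul, coeff_one, if_neg n.succ_ne_zero, zero_add]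
    simp only [coeff_sizeSeries_pow_mul_bridgeSeries]
    rw [tsum_eq_sum (s := Finset.range (n + 1)), bridgeSeries, coeff_mk]
    · have h := succ_mul_sumProb_succ p n n
      rw [ENNReal.mul_right_inj (by simp) (by simp)] at h
      rw [h]
      refine Finset.sum_congr rfl fun j hj => ?_
      rw [Finset.mem_range] at hj
      rw [if_pos (by omega)]
    · intro j hj
      rw [Finset.mem_range] at hj
      rw [if_neg (by omega), mul_zero]

theorem eq_of_eq_add_X_mul {A Φ H H' : PowerSeries ℝ≥0∞} (h : H = Φ + X * (A * H))
    (h' : H' = Φ + X * (A * H')) : H = H' := by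
  ext n
  induction n using Nat.strong_induction_on with
  | _ n ih =>
    rw [h, h', map_add, map_add]
    congr 1
    rcases n with _ | n
    · simp
    · rw [coeff_succ_X_mul, coeff_succ_X_mul, coeff_mul, coeff_mul]
      refine Finset.sum_congr rfl fun x hx => ?_
      rw [ih x.2 (by have := Finset.HasAntidiagonal.mem_antidiagonal.1 hx; omega)]

theorem treeSeries_fringeSum (f : PlaneTree → ℝ≥0∞) :
    treeSeries p (fringeSum f) = treeSeries p f * bridgeSeries p := by
  refine eq_of_eq_add_X_mul (A := compSize p (fun j => (j + 1 : ℕ) * p (j + 1)))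
    (Φ := treeSeries p f) ?_ ?_
  · rw [← treeSeries_sum_children (f := fun t => (t.children.map (fringeSum f)).sum)
      (h := fringeSum f) (fun _ => rfl), ← treeSeries_add]
    congr 1
    ext ⟨ts⟩
    exact fringeSum_node f ts
  · nth_rewrite 1 [bridgeSeries_eq]
    ring

theorem mul_probSize (p : ℕ → ℝ≥0∞) {n : ℕ} (hn : 1 ≤ n) :
    n * probSize p n = sumProb p n (n - 1) := by
  have h := coeff_sizeSeries_pow_mul_bridgeSeries (p := p) n 1
  rw [if_pos hn, pow_one, sizeSeries, ← treeSeries_fringeSum, treeSeries, coeff_mk] at h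
  rw [← h, probSize, ← ENNReal.tsum_mul_left]
  refine tsum_congr fun t => ?_
  split_ifs with ht
  · rw [fringeSum_one, ht, mul_comm]
  · simp

theorem coeff_compSize_mul_le {c : ℕ → ℝ≥0∞} {Z : PowerSeries ℝ≥0∞} {n : ℕ} {M : ℝ≥0∞}
    (h : ∀ r, coeff n (sizeSeries p ^ r * Z) ≤ M) (r : ℕ) :
    coeff n (sizeSeries p ^ r * (compSize p c * Z)) ≤ (∑' j, c j) * M := by
  rw [mul_left_comm, coeff_compSize_mul, ← ENNReal.tsum_mul_right]
  refine ENNReal.tsum_le_tsum fun j => ?_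
  rw [← mul_assoc, ← pow_add]
  gcongr
  exact h _

theorem coeff_compSize_pow_mul_le {c : ℕ → ℝ≥0∞} (hc : ∑' j, c j = 1) {Z : PowerSeries ℝ≥0∞}
    {n : ℕ} {M : ℝ≥0∞} (h : ∀ r, coeff n (sizeSeries p ^ r * Z) ≤ M) (k r : ℕ) :
    coeff n (sizeSeries p ^ r * (compSize p c ^ k * Z)) ≤ M := by
  induction k generalizing r with
  | zero => simpa using h r
  | succ k ih =>
    rw [pow_succ', mul_assoc]
    simpa [hc] using coeff_compSize_mul_le (c := c) ih r

theorem treeSeries_level (k : ℕ) :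
    treeSeries p (fun t => ((level t k).card : ℝ≥0∞)) =
      X ^ k * (compSize p (fun j => (j + 1 : ℕ) * p (j + 1)) ^ k * sizeSeries p) := by
  induction k with
  | zero => simp [card_level_zero, sizeSeries]
  | succ k ih =>
    rw [treeSeries_sum_children (h := fun t => ((level t k).card : ℝ≥0∞)), ih]
    · ring
    · intro ts
      rw [card_level_succ, Nat.cast_list_sum, List.map_map]
      rfl

theorem treeSeries_offDiag_level (i j : ℕ) :
    treeSeries p (fun t => offDiagSum (fun t => (level t i).card) (fun t => (level t j).card)
      t.children) = X ^ (i + j + 1) * (compSize p (fun j => ((j + 2) * (j + 1) : ℕ) * p (j + 2)) *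
        (compSize p (fun j => (j + 1 : ℕ) * p (j + 1)) ^ (i + j) * sizeSeries p ^ 2)) := by
  rw [treeSeries_offDiag_children (fun _ => rfl), treeSeries_level, treeSeries_level]
  ring

theorem coeff_bridge_le {n : ℕ} {M : ℝ≥0∞} (hM : ∀ s, sumProb p n s ≤ M) (r s : ℕ) :
    coeff n (sizeSeries p ^ r * (sizeSeries p ^ s * bridgeSeries p)) ≤ M := by
  rw [← mul_assoc, ← pow_add, coeff_sizeSeries_pow_mul_bridgeSeries]
  split_ifs
  · exact hM _
  · exact zero_le

theorem tsum_pairCount_le (hmean : ∑' j : ℕ, (j : ℝ≥0∞) * p j = 1) {k n : ℕ} (hk : 1 ≤ k)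
    (hkn : k ≤ n) {M : ℝ≥0∞} (hM : ∀ s, sumProb p (n - k) s ≤ M)
    (hM' : ∀ s, sumProb p (n - k + 1) s ≤ M) :
    (∑' t : PlaneTree, if size t = n then gwProb p t *
        ∑ᶠ u ∈ vertexSet t, (pairCountThrough t u k : ℝ≥0∞) else 0) ≤
      (1 + k * ∑' j : ℕ, ((j + 2) * (j + 1) : ℕ) * p (j + 2)) * M := by
  have hc : ∑' j : ℕ, ((j + 1 : ℕ) : ℝ≥0∞) * p (j + 1) = 1 := by
    rw [← hmean, tsum_eq_zero_add' (f := fun j : ℕ => (j : ℝ≥0∞) * p j) ENNReal.summable]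
    simp
  set f : PlaneTree → ℝ≥0∞ := fun t => (level t k).card + ∑ i ∈ Finset.range (k - 1),
    offDiagSum (fun t => (level t i).card) (fun t => (level t (k - 2 - i)).card) t.children with hf
  have hle : ∀ t, (rootPairCount t k : ℝ≥0∞) ≤ f t := by
    rintro ⟨ts⟩
    exact rootPairCount_node_le ts k
  calc _ ≤ coeff n (treeSeries p (fringeSum f)) := by
        rw [treeSeries, coeff_mk]
        refine ENNReal.tsum_le_tsum fun t => ?_
        split_ifs
        · gcongr
          exact finsum_pairCountThrough_le_fringeSum hle t
        · exact le_rfl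
    _ ≤ M + (k - 1 : ℕ) * ((∑' j : ℕ, ((j + 2) * (j + 1) : ℕ) * p (j + 2)) * M) := by
        rw [treeSeries_fringeSum, hf, treeSeries_add, treeSeries_sum, add_mul, map_add]
        refine add_le_add ?_ ?_
        · rw [treeSeries_level, mul_assoc]
          obtain ⟨m, rfl⟩ := Nat.exists_eq_add_of_le' hkn
          rw [coeff_X_pow_mul, mul_assoc]
          have := coeff_compSize_pow_mul_le (p := p) hc (n := m) (M := M)
            (fun r => coeff_bridge_le (by simpa using hM) r 1) k 0
          simpa using this
        · rw [Finset.sum_mul, map_sum]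
          refine le_trans (Finset.sum_le_card_nsmul _ _
            ((∑' j : ℕ, ((j + 2) * (j + 1) : ℕ) * p (j + 2)) * M) fun i hi => ?_) ?_
          · rw [Finset.mem_range] at hi
            rw [treeSeries_offDiag_level, mul_assoc]
            have hi' : i + (k - 2 - i) + 1 = k - 1 := by omega
            obtain ⟨m, hm⟩ := Nat.exists_eq_add_of_le' hkn
            have hm' : n = m + 1 + (k - 1) := by omega
            have hm'' : n - k + 1 = m + 1 := by omega
            rw [hi', hm', coeff_X_pow_mul, mul_assoc, mul_assoc]
            rw [hm''] at hM'
            have := coeff_compSize_mul_le (p := p)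
              (c := fun j : ℕ => ((j + 2) * (j + 1) : ℕ) * p (j + 2)) (n := m + 1) (M := M)
              (coeff_compSize_pow_mul_le hc (fun r => coeff_bridge_le hM' r 2)
                (i + (k - 2 - i))) 0
            simpa using this
          · simp
    _ ≤ (1 + k * ∑' j : ℕ, ((j + 2) * (j + 1) : ℕ) * p (j + 2)) * M := by
        rw [add_mul, one_mul, mul_assoc]
        gcongr
        omega

end PlaneTree

namespace PlaneTree

open Complex (I)

/-- The characteristic function of the distribution `q` on `ℕ`. -/
noncomputable def charSum (q : ℕ → ℝ) (t : ℝ) : ℂ :=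
  ∑' j : ℕ, (q j : ℂ) * Complex.exp ((j * t : ℝ) * I)

theorem norm_ofReal_mul_exp {x : ℝ} (hx : 0 ≤ x) (y : ℝ) : ‖(x : ℂ) * Complex.exp (y * I)‖ = x := by
  rw [norm_mul, Complex.norm_exp_ofReal_mul_I, mul_one, Complex.norm_real, Real.norm_of_nonneg hx]

theorem continuous_charSum {q : ℕ → ℝ} (hq : ∀ j, 0 ≤ q j) (hs : Summable q) :
    Continuous (charSum q) := by
  refine continuous_tsum (u := q) (fun j => by fun_prop) hs fun j t => ?_
  rw [norm_ofReal_mul_exp (hq j)]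

theorem norm_two_point_le {a b θ : ℝ} (ha : 0 ≤ a) (hb : 0 ≤ b) (hab : a + b ≤ 1) :
    ‖(a : ℂ) + b * Complex.exp (θ * I)‖ ≤ a + b - a * b * (1 - Real.cos θ) := by
  have hc := Real.cos_le_one θ
  have hc' := Real.neg_one_le_cos θ
  have hab0 := mul_nonneg ha hb
  have hδ : 0 ≤ a * b * (1 - Real.cos θ) := mul_nonneg hab0 (by linarith)
  have hnn : 0 ≤ a + b - a * b * (1 - Real.cos θ) := by nlinarith
  refine le_of_sq_le_sq ?_ hnn
  rw [Complex.sq_norm, Complex.normSq_apply]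
  have hre : ((a : ℂ) + b * Complex.exp (θ * I)).re = a + b * Real.cos θ := by
    simp [Complex.exp_ofReal_mul_I_re]
  have him : ((a : ℂ) + b * Complex.exp (θ * I)).im = b * Real.sin θ := by
    simp [Complex.exp_ofReal_mul_I_im]
  rw [hre, him]
  have hsin : b * Real.sin θ * (b * Real.sin θ) = b ^ 2 * (1 - Real.cos θ ^ 2) := by
    rw [← Real.sin_sq]
    ring
  rw [hsin]
  nlinarith [sq_nonneg (a * b * (1 - Real.cos θ)),
    mul_nonneg hδ (sub_nonneg.2 hab)]

theorem norm_charSum_le {q : ℕ → ℝ} (hq : ∀ j, 0 ≤ q j) (hs : HasSum q 1) {a : ℕ} (ha : a ≠ 0)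
    (t : ℝ) : ‖charSum q t‖ ≤ 1 - q 0 * q a * (1 - Real.cos (a * t)) := by
  have hnorm : ∀ j : ℕ, ‖(q j : ℂ) * Complex.exp ((j * t : ℝ) * I)‖ = q j :=
    fun j => norm_ofReal_mul_exp (hq j) _
  have hsum : Summable fun j : ℕ => (q j : ℂ) * Complex.exp ((j * t : ℝ) * I) :=
    Summable.of_norm (by simpa only [hnorm] using hs.summable)
  have h1 := hsum.sum_add_tsum_compl (s := {0, a})
  have h2 := hs.summable.sum_add_tsum_compl (s := {0, a})
  rw [hs.tsum_eq, Finset.sum_pair ha.symm] at h2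
  rw [Finset.sum_pair ha.symm] at h1
  have hrest : ‖∑' x : ↑((({0, a} : Finset ℕ) : Set ℕ)ᶜ),
      (q x : ℂ) * Complex.exp (((x : ℕ) * t : ℝ) * I)‖ ≤
      ∑' x : ↑((({0, a} : Finset ℕ) : Set ℕ)ᶜ), q x := by
    refine (norm_tsum_le_tsum_norm ?_).trans (le_of_eq ?_)
    · simp only [hnorm]
      exact hs.summable.subtype _
    · simp only [hnorm]
  have hle : q 0 + q a ≤ 1 := by
    have : 0 ≤ ∑' x : ↑((({0, a} : Finset ℕ) : Set ℕ)ᶜ), q x := tsum_nonneg fun x => hq x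
    linarith
  have h3 := norm_two_point_le (hq 0) (hq a) hle (θ := a * t)
  rw [charSum, ← h1]
  refine (norm_add_le _ _).trans ?_
  have h4 : (q 0 : ℂ) * Complex.exp (((0 : ℕ) * t : ℝ) * I) +
      (q a : ℂ) * Complex.exp ((a * t : ℝ) * I) = q 0 + q a * Complex.exp ((a * t : ℝ) * I) := by
    simp
  rw [h4]
  linarith

theorem exists_span {q : ℕ → ℝ} {a : ℕ} (ha : a ≠ 0) (hqa : q a ≠ 0) :
    ∃ d : ℕ, d ≠ 0 ∧ (∀ j, q j ≠ 0 → d ∣ j) ∧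
      ∀ t : ℝ, (∀ j : ℕ, q j ≠ 0 → Real.cos (j * t) = 1) → ∃ m : ℤ, m * (2 * Real.pi) = d * t := by
  obtain ⟨g, hg⟩ := Int.subgroup_cyclic (AddSubgroup.closure {z : ℤ | ∃ j : ℕ, q j ≠ 0 ∧ z = j})
  have hdvd : ∀ j, q j ≠ 0 → g.natAbs ∣ j := by
    intro j hj
    have hmem : (j : ℤ) ∈ AddSubgroup.closure {z : ℤ | ∃ j : ℕ, q j ≠ 0 ∧ z = j} :=
      AddSubgroup.subset_closure ⟨j, hj, rfl⟩
    rw [hg, AddSubgroup.mem_closure_singleton] at hmem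
    obtain ⟨n, hn⟩ := hmem
    have : g ∣ (j : ℤ) := ⟨n, by rw [← hn, smul_eq_mul, mul_comm]⟩
    exact Int.natAbs_dvd_natAbs.2 this
  refine ⟨g.natAbs, ?_, hdvd, ?_⟩
  · intro h0
    have := hdvd a hqa
    rw [h0, zero_dvd_iff] at this
    exact ha this
  · intro t ht
    let H : AddSubgroup ℤ := (AddSubgroup.zmultiples (2 * Real.pi)).comap
      ((AddMonoidHom.mulRight t).comp (Int.castAddHom ℝ))
    have hH : ∀ z : ℤ, z ∈ H ↔ ∃ m : ℤ, m * (2 * Real.pi) = z * t := by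
      intro z
      simp [H, AddSubgroup.mem_zmultiples_iff]
    have hle : AddSubgroup.closure {z : ℤ | ∃ j : ℕ, q j ≠ 0 ∧ z = j} ≤ H := by
      rw [AddSubgroup.closure_le]
      rintro _ ⟨j, hj, rfl⟩
      refine (hH _).2 ?_
      simpa using (Real.cos_eq_one_iff _).1 (ht j hj)
    have hgH : g ∈ H := hle (by rw [hg]; exact AddSubgroup.mem_closure_singleton_self g)
    have habs : (g.natAbs : ℤ) ∈ H := by
      rcases Int.natAbs_eq g with h | h
      · rwa [← h]
      · have := H.neg_mem hgH
        rwa [h, neg_neg] at this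
    simpa using (hH _).1 habs

theorem exists_norm_charSum_le_exp {q : ℕ → ℝ} (hq : ∀ j, 0 ≤ q j) (hs : HasSum q 1)
    (h0 : 0 < q 0) {a : ℕ} (ha : a ≠ 0) (hqa : 0 < q a) {d : ℕ} (hd : d ≠ 0)
    (hspan : ∀ t : ℝ, (∀ j : ℕ, q j ≠ 0 → Real.cos (j * t) = 1) →
      ∃ m : ℤ, m * (2 * Real.pi) = d * t) :
    ∃ c : ℝ, 0 < c ∧ ∀ t : ℝ, |t| ≤ Real.pi / d → ‖charSum q t‖ ≤ Real.exp (-c * t ^ 2) := by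
  have hpi := Real.pi_pos
  have hd' : (0 : ℝ) < d := by positivity
  have ha' : (0 : ℝ) < a := by positivity
  have hlt : ∀ t : ℝ, t ≠ 0 → |t| ≤ Real.pi / d → ‖charSum q t‖ < 1 := by
    intro t ht htd
    by_contra hge
    have hcos : ∀ j : ℕ, q j ≠ 0 → Real.cos (j * t) = 1 := by
      intro j hj
      rcases eq_or_ne j 0 with rfl | hj0
      · simp
      have h1 := norm_charSum_le hq hs hj0 t
      have h2 : 0 < q 0 * q j := mul_pos h0 (lt_of_le_of_ne (hq j) hj.symm)
      have h3 := Real.cos_le_one (j * t)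
      nlinarith
    obtain ⟨m, hm⟩ := hspan t hcos
    have h1 : |d * t| ≤ Real.pi := by
      rw [abs_mul, abs_of_pos hd']
      rwa [le_div_iff₀' hd'] at htd
    have hm0 : m ≠ 0 := by
      rintro rfl
      simp only [Int.cast_zero, zero_mul, zero_eq_mul] at hm
      rcases hm with h | h
      · exact hd'.ne' h
      · exact ht h
    have h2 : (1 : ℝ) ≤ |(m : ℝ)| := by exact_mod_cast Int.one_le_abs hm0
    rw [← hm, abs_mul, abs_of_pos (by positivity : (0 : ℝ) < 2 * Real.pi)] at h1
    nlinarith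
  have hcompact : IsCompact {t : ℝ | Real.pi / a ≤ |t| ∧ |t| ≤ Real.pi / d} := by
    refine (isCompact_Icc (a := -(Real.pi / d)) (b := Real.pi / d)).of_isClosed_subset ?_ ?_
    · exact (isClosed_le continuous_const continuous_abs).inter
        (isClosed_le continuous_abs continuous_const)
    · rintro t ⟨_, h⟩
      exact abs_le.1 h
  obtain ⟨ε, hε, hεle⟩ := hcompact.exists_forall_le' (f := fun t => 1 - ‖charSum q t‖) (a := 0)
    (continuous_const.sub (continuous_charSum hq hs.summable).norm).continuousOn (by
      rintro t ⟨h1, h2⟩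
      have : t ≠ 0 := by
        rintro rfl
        rw [abs_zero] at h1
        have : 0 < Real.pi / a := by positivity
        linarith
      linarith [hlt t this h2])
  refine ⟨min (q 0 * q a * (2 / Real.pi ^ 2 * a ^ 2)) (ε / (Real.pi / d) ^ 2), by positivity, ?_⟩
  intro t ht
  rw [neg_mul]
  refine le_trans ?_ (Real.one_sub_le_exp_neg _)
  by_cases hta : |t| ≤ Real.pi / a
  · have h1 := norm_charSum_le hq hs ha t
    have h2 : |a * t| ≤ Real.pi := by
      rw [abs_mul, abs_of_pos ha']
      rwa [le_div_iff₀' ha'] at hta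
    have h3 := Real.cos_le_one_sub_mul_cos_sq h2
    have h4 : min (q 0 * q a * (2 / Real.pi ^ 2 * a ^ 2)) (ε / (Real.pi / d) ^ 2) * t ^ 2 ≤
        q 0 * q a * (2 / Real.pi ^ 2 * a ^ 2) * t ^ 2 :=
      mul_le_mul_of_nonneg_right (min_le_left _ _) (sq_nonneg t)
    have h5 : q 0 * q a * (2 / Real.pi ^ 2 * (a * t) ^ 2) ≤
        q 0 * q a * (1 - Real.cos (a * t)) :=
      mul_le_mul_of_nonneg_left (by linarith) (by positivity)
    have h6 : q 0 * q a * (2 / Real.pi ^ 2 * (a * t) ^ 2) =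
      q 0 * q a * (2 / Real.pi ^ 2 * a ^ 2) * t ^ 2 := by ring
    linarith
  · have h1 := hεle t ⟨(not_le.1 hta).le, ht⟩
    have h4 : min (q 0 * q a * (2 / Real.pi ^ 2 * a ^ 2)) (ε / (Real.pi / d) ^ 2) * t ^ 2 ≤
        ε / (Real.pi / d) ^ 2 * t ^ 2 :=
      mul_le_mul_of_nonneg_right (min_le_right _ _) (sq_nonneg t)
    have h5 : t ^ 2 ≤ (Real.pi / d) ^ 2 := sq_le_sq' (abs_le.1 ht).1 (abs_le.1 ht).2
    have h6 : ε / (Real.pi / d) ^ 2 * t ^ 2 ≤ ε := by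
      rw [div_mul_eq_mul_div, div_le_iff₀ (by positivity)]
      exact mul_le_mul_of_nonneg_left h5 hε.le
    linarith

end PlaneTree

namespace PlaneTree

open Complex (I)
open MeasureTheory ProbabilityTheory
open scoped Topology

variable {p : ℕ → ℝ≥0∞}

theorem ne_top_of_tsum_eq_one (hp : ∑' k, p k = 1) (k : ℕ) : p k ≠ ⊤ :=
  ne_top_of_le_ne_top (by simp [hp]) (ENNReal.le_tsum k)

theorem hasSum_toReal_of_tsum_eq_one (hp : ∑' k, p k = 1) : HasSum (fun k => (p k).toReal) 1 := by
  have h := ENNReal.hasSum_toReal (f := p) (by simp [hp])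
  rwa [← ENNReal.tsum_toReal_eq (ne_top_of_tsum_eq_one hp), hp, ENNReal.toReal_one] at h

theorem sumProb_zero (p : ℕ → ℝ≥0∞) (s : ℕ) : sumProb p 0 s = if s = 0 then 1 else 0 := by
  rw [sumProb, pow_zero, PowerSeries.coeff_one]

theorem sumProb_ne_top (hp : ∑' k, p k = 1) (n s : ℕ) : sumProb p n s ≠ ⊤ := by
  induction n generalizing s with
  | zero =>
    rw [sumProb_zero]
    split_ifs <;> simp
  | succ n ih =>
    rw [sumProb_succ]
    exact ENNReal.sum_ne_top.2 fun j _ => ENNReal.mul_ne_top (ne_top_of_tsum_eq_one hp j) (ih _)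

theorem toReal_sumProb_succ (hp : ∑' k, p k = 1) (n s : ℕ) :
    (sumProb p (n + 1) s).toReal =
      ∑ x ∈ Finset.HasAntidiagonal.antidiagonal s, (p x.1).toReal * (sumProb p n x.2).toReal := by
  rw [sumProb_succ, Finset.Nat.sum_antidiagonal_eq_sum_range_succ_mk, ENNReal.toReal_sum]
  · simp only [ENNReal.toReal_mul]
  · exact fun j _ => ENNReal.mul_ne_top (ne_top_of_tsum_eq_one hp j) (sumProb_ne_top hp _ _)

theorem dvd_of_sumProb_ne_zero {d : ℕ} (hd : ∀ j, p j ≠ 0 → d ∣ j) {n s : ℕ}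
    (h : sumProb p n s ≠ 0) : d ∣ s := by
  induction n generalizing s with
  | zero =>
    rw [sumProb_zero] at h
    have : s = 0 := by
      by_contra h0
      simp [h0] at h
    simp [this]
  | succ n ih =>
    rw [sumProb_succ] at h
    obtain ⟨j, hj, hne⟩ := Finset.exists_ne_zero_of_sum_ne_zero h
    rw [Finset.mem_range] at hj
    have h1 := hd j (left_ne_zero_of_mul hne)
    have h2 := ih (right_ne_zero_of_mul hne)
    have : s = j + (s - j) := by omega
    rw [this]
    exact h1.add h2

theorem hasSum_sumProb_mul_exp (hp : ∑' k, p k = 1) (n : ℕ) (t : ℝ) :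
    (Summable fun s => (sumProb p n s).toReal) ∧
      HasSum (fun s : ℕ => ((sumProb p n s).toReal : ℂ) * Complex.exp ((s * t : ℝ) * I))
        (charSum (fun k => (p k).toReal) t ^ n) := by
  have hnorm : ∀ n s : ℕ, ‖((sumProb p n s).toReal : ℂ) * Complex.exp ((s * t : ℝ) * I)‖ =
      (sumProb p n s).toReal := fun n s => norm_ofReal_mul_exp ENNReal.toReal_nonneg _
  have hnorm' : ∀ s : ℕ, ‖((p s).toReal : ℂ) * Complex.exp ((s * t : ℝ) * I)‖ =
      (p s).toReal := fun s => norm_ofReal_mul_exp ENNReal.toReal_nonneg _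
  induction n with
  | zero =>
    simp only [sumProb_zero, pow_zero]
    constructor
    · refine summable_of_ne_finset_zero (s := {0}) fun s hs => ?_
      rw [Finset.mem_singleton] at hs
      simp [hs]
    · convert hasSum_single (f := fun s : ℕ =>
        (((if s = 0 then 1 else 0 : ℝ≥0∞)).toReal : ℂ) * Complex.exp ((s * t : ℝ) * I)) 0 ?_ using 1
      · simp
      · intro s hs
        simp [hs]
  | succ n ih =>
    have h1 : Summable fun s : ℕ => ‖((p s).toReal : ℂ) * Complex.exp ((s * t : ℝ) * I)‖ := by
      simpa only [hnorm'] using (hasSum_toReal_of_tsum_eq_one hp).summable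
    have h2 : Summable fun s : ℕ =>
        ‖((sumProb p n s).toReal : ℂ) * Complex.exp ((s * t : ℝ) * I)‖ := by
      simpa only [hnorm] using ih.1
    have hterm : ∀ s : ℕ, ∑ x ∈ Finset.HasAntidiagonal.antidiagonal s,
        ((p x.1).toReal : ℂ) * Complex.exp ((x.1 * t : ℝ) * I) *
          (((sumProb p n x.2).toReal : ℂ) * Complex.exp ((x.2 * t : ℝ) * I)) =
        ((sumProb p (n + 1) s).toReal : ℂ) * Complex.exp ((s * t : ℝ) * I) := by
      intro s
      rw [toReal_sumProb_succ hp, Complex.ofReal_sum, Finset.sum_mul]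
      refine Finset.sum_congr rfl fun x hx => ?_
      rw [← Finset.HasAntidiagonal.mem_antidiagonal.1 hx]
      push_cast
      rw [add_mul, add_mul, Complex.exp_add]
      ring
    have h3 := summable_norm_sum_mul_antidiagonal_of_summable_norm h1 h2
    have h4 := tsum_mul_tsum_eq_tsum_sum_antidiagonal_of_summable_norm h1 h2
    simp only [hterm] at h3 h4
    refine ⟨by simpa only [hnorm] using h3, ?_⟩
    rw [pow_succ', ← ih.2.tsum_eq, charSum, h4]
    exact h3.of_norm.hasSum

theorem integral_exp_int_mul {d : ℕ} (hd : d ≠ 0) {z : ℤ} (hz : (d : ℤ) ∣ z) :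
    ∫ t in (-(Real.pi / d))..(Real.pi / d), Complex.exp ((z * t : ℝ) * I) =
      if z = 0 then (2 * Real.pi / d : ℂ) else 0 := by
  have hd' : (d : ℂ) ≠ 0 := by exact_mod_cast hd
  split_ifs with h0
  · subst h0
    simp
    ring
  · obtain ⟨m, rfl⟩ := hz
    have hm : (m : ℂ) ≠ 0 := by
      have : m ≠ 0 := right_ne_zero_of_mul h0
      exact_mod_cast this
    have hc : (d * m : ℂ) * I ≠ 0 := mul_ne_zero (mul_ne_zero hd' hm) Complex.I_ne_zero
    have := integral_exp_mul_complex (a := -(Real.pi / d)) (b := Real.pi / d) hc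
    have hrw : ∀ t : ℝ, Complex.exp ((((d * m : ℤ) : ℝ) * t : ℝ) * I) =
        Complex.exp ((d * m : ℂ) * I * t) := by
      intro t
      congr 1
      push_cast
      ring
    simp only [hrw]
    rw [this, div_eq_zero_iff]
    left
    rw [sub_eq_zero, Complex.exp_eq_exp_iff_exists_int]
    refine ⟨m, ?_⟩
    push_cast
    field_simp
    ring

theorem integral_charSum_pow (hp : ∑' k, p k = 1) {d : ℕ} (hd : d ≠ 0)
    (hdvd : ∀ j, p j ≠ 0 → d ∣ j) {n s : ℕ} (hs : d ∣ s) :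
    ∫ t in (-(Real.pi / d))..(Real.pi / d),
      charSum (fun k => (p k).toReal) t ^ n * Complex.exp ((-(s * t) : ℝ) * I) =
      (2 * Real.pi / d : ℂ) * (sumProb p n s).toReal := by
  have hnorm : ∀ (r : ℕ) (t : ℝ), ‖((sumProb p n r).toReal : ℂ) * Complex.exp ((r * t : ℝ) * I) *
      Complex.exp ((-(s * t) : ℝ) * I)‖ = (sumProb p n r).toReal := by
    intro r t
    rw [norm_mul, Complex.norm_exp_ofReal_mul_I, mul_one,
      norm_ofReal_mul_exp ENNReal.toReal_nonneg]
  have h := intervalIntegral.hasSum_integral_of_dominated_convergence (μ := volume)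
    (a := -(Real.pi / d)) (b := Real.pi / d)
    (F := fun (r : ℕ) (t : ℝ) => ((sumProb p n r).toReal : ℂ) * Complex.exp ((r * t : ℝ) * I) *
      Complex.exp ((-(s * t) : ℝ) * I))
    (f := fun t => charSum (fun k => (p k).toReal) t ^ n * Complex.exp ((-(s * t) : ℝ) * I))
    (fun r _ => (sumProb p n r).toReal)
    (fun r => (by fun_prop : Continuous _).aestronglyMeasurable)
    (fun r => Eventually.of_forall fun t _ => (hnorm r t).le)
    (Eventually.of_forall fun t _ => (hasSum_sumProb_mul_exp hp n t).1)
    (by simp)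
    (Eventually.of_forall fun t _ => (hasSum_sumProb_mul_exp hp n t).2.mul_right _)
  rw [← h.tsum_eq, tsum_eq_single s]
  · have hrw : ∀ t : ℝ, ((sumProb p n s).toReal : ℂ) * Complex.exp ((s * t : ℝ) * I) *
        Complex.exp ((-(s * t) : ℝ) * I) =
        ((sumProb p n s).toReal : ℂ) * Complex.exp ((((0 : ℤ) : ℝ) * t : ℝ) * I) := by
      intro t
      rw [mul_assoc, ← Complex.exp_add]
      congr 2
      push_cast
      ring
    simp only [hrw]
    rw [intervalIntegral.integral_const_mul, integral_exp_int_mul hd (dvd_zero _), if_pos rfl,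
      mul_comm]
  · intro r hr
    by_cases h0 : sumProb p n r = 0
    · simp [h0]
    have hrd := dvd_of_sumProb_ne_zero hdvd h0
    have hrw : ∀ t : ℝ, ((sumProb p n r).toReal : ℂ) * Complex.exp ((r * t : ℝ) * I) *
        Complex.exp ((-(s * t) : ℝ) * I) =
        ((sumProb p n r).toReal : ℂ) * Complex.exp ((((r - s : ℤ) : ℝ) * t : ℝ) * I) := by
      intro t
      rw [mul_assoc, ← Complex.exp_add]
      congr 2
      push_cast
      ring
    simp only [hrw]
    rw [intervalIntegral.integral_const_mul, integral_exp_int_mul hd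
      (dvd_sub (Int.natCast_dvd_natCast.2 hrd) (Int.natCast_dvd_natCast.2 hs)), if_neg, mul_zero]
    omega

theorem tendsto_charSum_mul_exp_pow (hp : ∑' k, p k = 1)
    (hmean : ∑' k : ℕ, (k : ℝ≥0∞) * p k = 1) (hvar_pos : 0 < xiVar p) (hvar_fin : xiVar p ≠ ⊤)
    (x : ℝ) :
    Tendsto (fun n : ℕ => (charSum (fun k => (p k).toReal) (x / √n) *
        Complex.exp ((-(x / √n) : ℝ) * I)) ^ n) atTop
      (𝓝 (Real.exp (-((xiVar p).toReal / 2) * x ^ 2) : ℝ)) := by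
  set v := (xiVar p).toReal with hv
  have hvpos : 0 < v := ENNReal.toReal_pos hvar_pos.ne' hvar_fin
  have hσ : √v ≠ 0 := (Real.sqrt_pos.2 hvpos).ne'
  let P : PMF ℕ := ⟨p, hp ▸ ENNReal.summable.hasSum⟩
  have hPp : ∀ j, P j = p j := fun _ => rfl
  have hPs : ∀ j, P.toMeasure {j} = p j := fun j =>
    P.toMeasure_apply_singleton j (measurableSet_singleton j)
  have hlin : ∀ f : ℕ → ℝ≥0∞, ∫⁻ j, f j ∂P.toMeasure = ∑' j, f j * p j := by
    intro f
    rw [lintegral_countable']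
    simp only [hPs]
  have hintegrable : Integrable (fun j : ℕ => (j : ℝ)) P.toMeasure := by
    refine ⟨.of_discrete, ?_⟩
    rw [hasFiniteIntegral_iff_ofReal (Eventually.of_forall fun j => Nat.cast_nonneg j), hlin]
    simp [hmean]
  have hmean' : ∫ j : ℕ, (j : ℝ) ∂P.toMeasure = 1 := by
    rw [integral_eq_lintegral_of_nonneg_ae (Eventually.of_forall fun j => Nat.cast_nonneg j)
      .of_discrete, hlin]
    simp [hmean]
  have hvar' : ∫ j : ℕ, ((j : ℝ) - 1) ^ 2 ∂P.toMeasure = v := by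
    rw [integral_eq_lintegral_of_nonneg_ae (Eventually.of_forall fun j => sq_nonneg _)
      .of_discrete, hlin, hv, xiVar]
    simp only [mul_comm]
  let X : ℕ → ℝ := fun j => ((j : ℝ) - 1) / √v
  have h0 : P.toMeasure[X] = 0 := by
    simp only [X]
    rw [integral_div, integral_sub hintegrable (integrable_const _), hmean']
    simp
  have h1 : P.toMeasure[X ^ 2] = 1 := by
    have : X ^ 2 = fun j : ℕ => ((j : ℝ) - 1) ^ 2 / v := by
      funext j
      simp only [X, Pi.pow_apply, div_pow, Real.sq_sqrt hvpos.le]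
    rw [this, integral_div, hvar', div_self hvpos.ne']
  have hX : AEMeasurable X P.toMeasure := (Measurable.of_discrete).aemeasurable
  have hlim := tendsto_charFun_inv_sqrt_mul_pow hX h0 h1 (√v * x)
  have hchar : ∀ n : ℕ, charFun (P.toMeasure.map X) ((√n)⁻¹ * (√v * x)) =
      charSum (fun k => (p k).toReal) (x / √n) * Complex.exp ((-(x / √n) : ℝ) * I) := by
    intro n
    rw [charFun_apply_real, integral_map hX (by fun_prop), PMF.integral_eq_tsum, charSum,
      ← tsum_mul_right]
    · refine tsum_congr fun j => ?_
      rw [hPp, Complex.real_smul, mul_assoc ((p j).toReal : ℂ), ← Complex.exp_add]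
      congr 2
      have : (√n)⁻¹ * (√v * x) * X j = j * (x / √n) + -(x / √n) := by
        simp only [X]
        field_simp
        ring
      rw [← add_mul, ← Complex.ofReal_add, ← this]
      push_cast
      ring
    · refine (integrable_const (1 : ℝ)).mono' .of_discrete (Eventually.of_forall fun j => ?_)
      rw [← Complex.ofReal_mul, Complex.norm_exp_ofReal_mul_I]
  simp only [hchar] at hlim
  convert hlim using 2
  push_cast
  congr 1
  rw [mul_pow, ← Complex.ofReal_pow (√v), Real.sq_sqrt hvpos.le]
  ring

theorem prob_zero_ne_zero (hp : ∑' k, p k = 1)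
    (hmean : ∑' k : ℕ, (k : ℝ≥0∞) * p k = 1) (hvar_pos : 0 < xiVar p) : p 0 ≠ 0 := by
  intro h0
  have hle : ∀ k : ℕ, p k ≤ (k : ℝ≥0∞) * p k := by
    intro k
    rcases Nat.eq_zero_or_pos k with rfl | hk
    · simp [h0]
    · exact le_mul_of_one_le_left' (by exact_mod_cast hk)
  have hsub : ∑' k : ℕ, ((k : ℝ≥0∞) * p k - p k) = 0 := by
    rw [ENNReal.tsum_sub (by simp [hp]) hle, hp, hmean, tsub_self]
  rw [ENNReal.tsum_eq_zero] at hsub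
  refine hvar_pos.ne' (ENNReal.tsum_eq_zero.2 fun k => ?_)
  rcases eq_or_ne k 1 with rfl | hk
  · simp
  suffices p k = 0 by simp [this]
  rcases Nat.eq_zero_or_pos k with rfl | hk0
  · exact h0
  by_contra hpk
  have htop := ne_top_of_tsum_eq_one hp k
  have h2 : (2 : ℝ≥0∞) * p k ≤ p k := calc
    (2 : ℝ≥0∞) * p k ≤ (k : ℝ≥0∞) * p k := by
      gcongr
      exact_mod_cast (by omega : 2 ≤ k)
    _ ≤ p k := tsub_eq_zero_iff_le.1 (hsub k)
  rw [two_mul] at h2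
  exact absurd h2 (not_le.2 (ENNReal.lt_add_right htop hpk))

theorem exists_span_and_decay (hp : ∑' k, p k = 1)
    (hmean : ∑' k : ℕ, (k : ℝ≥0∞) * p k = 1) (hvar_pos : 0 < xiVar p) :
    ∃ d : ℕ, d ≠ 0 ∧ (∀ j, p j ≠ 0 → d ∣ j) ∧ ∃ c : ℝ, 0 < c ∧
      ∀ t : ℝ, |t| ≤ Real.pi / d → ‖charSum (fun k => (p k).toReal) t‖ ≤ Real.exp (-c * t ^ 2) := by
  have hne : ∀ j, (p j).toReal ≠ 0 ↔ p j ≠ 0 := fun j => by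
    simp [ENNReal.toReal_eq_zero_iff, ne_top_of_tsum_eq_one hp j]
  have hpos : ∀ j, p j ≠ 0 → 0 < (p j).toReal := fun j h =>
    ENNReal.toReal_nonneg.lt_of_ne' ((hne j).2 h)
  obtain ⟨a, ha⟩ : ∃ a : ℕ, (a : ℝ≥0∞) * p a ≠ 0 := by
    by_contra! h
    simp [h] at hmean
  have ha0 : a ≠ 0 := by exact_mod_cast left_ne_zero_of_mul ha
  have hpa : p a ≠ 0 := right_ne_zero_of_mul ha
  obtain ⟨d, hd, hdvd, hspan⟩ := exists_span (q := fun k => (p k).toReal) ha0 ((hne a).2 hpa)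
  refine ⟨d, hd, fun j hj => hdvd j ((hne j).2 hj), ?_⟩
  exact exists_norm_charSum_le_exp (fun _ => ENNReal.toReal_nonneg)
    (hasSum_toReal_of_tsum_eq_one hp) (hpos 0 (prob_zero_ne_zero hp hmean hvar_pos)) ha0
    (hpos a hpa) hd hspan

theorem toReal_sumProb_le (hp : ∑' k, p k = 1) {d : ℕ} (hd : d ≠ 0)
    (hdvd : ∀ j, p j ≠ 0 → d ∣ j) {c : ℝ} (hc : 0 < c)
    (hdecay : ∀ t : ℝ, |t| ≤ Real.pi / d →
      ‖charSum (fun k => (p k).toReal) t‖ ≤ Real.exp (-c * t ^ 2)) {n : ℕ} (hn : 1 ≤ n) (s : ℕ) :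
    (sumProb p n s).toReal ≤ d / (2 * Real.pi) * √(Real.pi / c) / √n := by
  have hn' : (0 : ℝ) < n := by exact_mod_cast hn
  have hd' : (0 : ℝ) < d := by exact_mod_cast Nat.pos_of_ne_zero hd
  have hpi := Real.pi_pos
  by_cases h0 : sumProb p n s = 0
  · rw [h0, ENNReal.toReal_zero]
    positivity
  have hle : -(Real.pi / d) ≤ Real.pi / d := by
    have : 0 < Real.pi / d := by positivity
    linarith
  have hcn : 0 < c * n := by positivity
  have hI : Integrable fun t : ℝ => Real.exp (-(c * n) * t ^ 2) := integrable_exp_neg_mul_sq hcn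
  have h := congrArg norm (integral_charSum_pow hp hd hdvd (dvd_of_sumProb_ne_zero hdvd h0)
    (n := n) (s := s))
  have hbound : ‖∫ t in (-(Real.pi / d))..(Real.pi / d),
      charSum (fun k => (p k).toReal) t ^ n * Complex.exp ((-(s * t) : ℝ) * I)‖ ≤
      √(Real.pi / (c * n)) := by
    refine (intervalIntegral.norm_integral_le_of_norm_le (g := fun t : ℝ =>
      Real.exp (-(c * n) * t ^ 2)) hle (Eventually.of_forall fun t ht => ?_)
      hI.intervalIntegrable).trans ?_
    · rw [norm_mul, Complex.norm_exp_ofReal_mul_I, mul_one, norm_pow]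
      refine (pow_le_pow_left₀ (norm_nonneg _) (hdecay t (abs_le.2 ⟨ht.1.le, ht.2⟩)) n).trans ?_
      rw [← Real.exp_nat_mul]
      exact (congrArg Real.exp (by ring)).le
    · rw [intervalIntegral.integral_of_le hle, ← integral_gaussian]
      exact setIntegral_le_integral hI (Eventually.of_forall fun t => (Real.exp_pos _).le)
  rw [h, norm_mul] at hbound
  have hnorm : ‖(2 * Real.pi / d : ℂ)‖ = 2 * Real.pi / d := by
    have : (2 * Real.pi / d : ℂ) = ((2 * Real.pi / d : ℝ) : ℂ) := by push_cast; rfl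
    rw [this, Complex.norm_real, Real.norm_of_nonneg (by positivity)]
  rw [hnorm, Complex.norm_real, Real.norm_of_nonneg ENNReal.toReal_nonneg,
    ← div_div, Real.sqrt_div (by positivity), ← le_div_iff₀' (by positivity)] at hbound
  refine hbound.trans (le_of_eq ?_)
  field_simp

/-- The integrand of the Fourier inversion formula for the probability that the random walk
with steps `p` is at `n - 1` after `n` steps, rescaled by `√n`. -/
noncomputable def rescaledIntegrand (p : ℕ → ℝ≥0∞) (d n : ℕ) (x : ℝ) : ℂ :=
  (Ioc (-(√n * (Real.pi / d))) (√n * (Real.pi / d))).indicator (fun x =>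
    (charSum (fun k => (p k).toReal) (x / √n) * Complex.exp ((-(x / √n) : ℝ) * I)) ^ n *
      Complex.exp ((x / √n : ℝ) * I)) x

theorem integral_rescaledIntegrand (hp : ∑' k, p k = 1) {d : ℕ} (hd : d ≠ 0)
    (hdvd : ∀ j, p j ≠ 0 → d ∣ j) {n : ℕ} (hn : 1 ≤ n) (hs : d ∣ n - 1) :
    ∫ x, rescaledIntegrand p d n x =
      ((2 * Real.pi / d * (√n * (sumProb p n (n - 1)).toReal) : ℝ) : ℂ) := by
  have hn' : (0 : ℝ) < n := by exact_mod_cast hn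
  have hsq : 0 < √(n : ℝ) := Real.sqrt_pos.2 hn'
  have hpi := Real.pi_pos
  have hle : -(√n * (Real.pi / d)) ≤ √n * (Real.pi / d) := by
    have : 0 ≤ √n * (Real.pi / d) := by positivity
    linarith
  simp only [rescaledIntegrand]
  rw [integral_indicator measurableSet_Ioc, ← intervalIntegral.integral_of_le hle,
    intervalIntegral.integral_comp_div (fun t => (charSum (fun k => (p k).toReal) t *
      Complex.exp ((-t : ℝ) * I)) ^ n * Complex.exp ((t : ℝ) * I)) hsq.ne', neg_div,
    mul_div_cancel_left₀ _ hsq.ne']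
  have hrw : ∀ t : ℝ, (charSum (fun k => (p k).toReal) t * Complex.exp ((-t : ℝ) * I)) ^ n *
      Complex.exp ((t : ℝ) * I) = charSum (fun k => (p k).toReal) t ^ n *
        Complex.exp ((-((n - 1 : ℕ) * t) : ℝ) * I) := by
    intro t
    rw [mul_pow, mul_assoc, ← Complex.exp_nat_mul, ← Complex.exp_add]
    congr 2
    push_cast [Nat.cast_sub hn]
    ring
  simp only [hrw]
  rw [integral_charSum_pow hp hd hdvd hs, Complex.real_smul]
  push_cast
  ring

theorem tendsto_integral_rescaledIntegrand (hp : ∑' k, p k = 1)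
    (hmean : ∑' k : ℕ, (k : ℝ≥0∞) * p k = 1) (hvar_pos : 0 < xiVar p) (hvar_fin : xiVar p ≠ ⊤)
    {d : ℕ} (hd : d ≠ 0) {c : ℝ} (hc : 0 < c)
    (hdecay : ∀ t : ℝ, |t| ≤ Real.pi / d →
      ‖charSum (fun k => (p k).toReal) t‖ ≤ Real.exp (-c * t ^ 2)) :
    Tendsto (fun n : ℕ => ∫ x, rescaledIntegrand p d n x) atTop
      (𝓝 (√(Real.pi / ((xiVar p).toReal / 2)) : ℝ)) := by
  have hpi := Real.pi_pos
  have hd' : (0 : ℝ) < d := by exact_mod_cast Nat.pos_of_ne_zero hd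
  rw [← integral_gaussian, ← integral_complex_ofReal]
  have hcont := continuous_charSum (fun k => ENNReal.toReal_nonneg (a := p k))
    (hasSum_toReal_of_tsum_eq_one hp).summable
  refine tendsto_integral_filter_of_dominated_convergence (fun x => Real.exp (-c * x ^ 2))
    ?_ ?_ (integrable_exp_neg_mul_sq hc) ?_
  · refine Eventually.of_forall fun n => ?_
    unfold rescaledIntegrand
    refine AEStronglyMeasurable.indicator ?_ measurableSet_Ioc
    have : Continuous fun x : ℝ => charSum (fun k => (p k).toReal) (x / √n) :=
      hcont.comp (by fun_prop)
    exact (by fun_prop : Continuous _).aestronglyMeasurable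
  · filter_upwards [eventually_ge_atTop 1] with n hn
    refine Eventually.of_forall fun x => ?_
    have hn' : (0 : ℝ) < n := by exact_mod_cast hn
    have hsq : 0 < √(n : ℝ) := Real.sqrt_pos.2 hn'
    rw [rescaledIntegrand, indicator_apply]
    split_ifs with hx
    · rw [norm_mul, norm_pow, norm_mul, Complex.norm_exp_ofReal_mul_I,
        Complex.norm_exp_ofReal_mul_I, mul_one, mul_one]
      have habs : |x / √n| ≤ Real.pi / d := by
        rw [abs_div, abs_of_pos hsq, div_le_iff₀' hsq]
        exact abs_le.2 ⟨hx.1.le, hx.2⟩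
      refine (pow_le_pow_left₀ (norm_nonneg _) (hdecay _ habs) n).trans ?_
      rw [← Real.exp_nat_mul, div_pow, Real.sq_sqrt hn'.le]
      refine (congrArg Real.exp ?_).le
      field_simp
    · rw [norm_zero]
      exact (Real.exp_pos _).le
  · refine Eventually.of_forall fun x => ?_
    have hsqrt : Tendsto (fun n : ℕ => √(n : ℝ)) atTop atTop :=
      Real.tendsto_sqrt_atTop.comp tendsto_natCast_atTop_atTop
    have h1 := tendsto_charSum_mul_exp_pow hp hmean hvar_pos hvar_fin x
    have h2 : Tendsto (fun n : ℕ => Complex.exp ((x / √n : ℝ) * I)) atTop (𝓝 1) := by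
      have h := (hsqrt.const_div_atTop x)
      have hc : Continuous fun y : ℝ => Complex.exp ((y : ℝ) * I) := by fun_prop
      simpa [Function.comp_def] using (hc.tendsto 0).comp h
    have h3 := h1.mul h2
    rw [mul_one] at h3
    refine h3.congr' ?_
    filter_upwards [hsqrt.eventually_gt_atTop (|x| / (Real.pi / d))] with n hn
    rw [div_lt_iff₀ (by positivity)] at hn
    rw [rescaledIntegrand, indicator_of_mem]
    have := abs_lt.1 hn
    exact ⟨this.1, this.2.le⟩

theorem exists_pos_le_of_ne_zero {g : ℕ → ℝ} (hg : ∀ n, 0 ≤ g n) (N : ℕ) :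
    ∃ c : ℝ, 0 < c ∧ ∀ n < N, g n ≠ 0 → c ≤ g n := by
  induction N with
  | zero => exact ⟨1, one_pos, by simp⟩
  | succ N ih =>
    obtain ⟨c, hc, h⟩ := ih
    by_cases hN : g N = 0
    · refine ⟨c, hc, fun n hn hne => h n ?_ hne⟩
      have : n ≠ N := fun h => hne (h ▸ hN)
      omega
    · refine ⟨min c (g N), lt_min hc ((hg N).lt_of_ne' hN), fun n hn hne => ?_⟩
      rcases Nat.lt_succ_iff_lt_or_eq.1 hn with h' | rfl
      · exact (min_le_left _ _).trans (h n h' hne)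
      · exact min_le_right _ _

theorem exists_le_sqrt_mul_sumProb (hp : ∑' k, p k = 1)
    (hmean : ∑' k : ℕ, (k : ℝ≥0∞) * p k = 1) (hvar_pos : 0 < xiVar p) (hvar_fin : xiVar p ≠ ⊤)
    {d : ℕ} (hd : d ≠ 0) (hdvd : ∀ j, p j ≠ 0 → d ∣ j) {c : ℝ} (hc : 0 < c)
    (hdecay : ∀ t : ℝ, |t| ≤ Real.pi / d →
      ‖charSum (fun k => (p k).toReal) t‖ ≤ Real.exp (-c * t ^ 2)) :
    ∃ b : ℝ, 0 < b ∧ ∀ n, 1 ≤ n → sumProb p n (n - 1) ≠ 0 →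
      b ≤ √n * (sumProb p n (n - 1)).toReal := by
  have hpi := Real.pi_pos
  have hd' : (0 : ℝ) < d := by exact_mod_cast Nat.pos_of_ne_zero hd
  have hvpos : 0 < (xiVar p).toReal := ENNReal.toReal_pos hvar_pos.ne' hvar_fin
  set G := √(Real.pi / ((xiVar p).toReal / 2)) with hG
  have hGpos : 0 < G := Real.sqrt_pos.2 (by positivity)
  have hlim := (Complex.continuous_re.tendsto _).comp
    (tendsto_integral_rescaledIntegrand hp hmean hvar_pos hvar_fin hd hc hdecay)
  rw [Complex.ofReal_re, ← hG] at hlim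
  obtain ⟨N, hN⟩ := eventually_atTop.1 (hlim.eventually_const_lt (half_lt_self hGpos))
  obtain ⟨b, hb, hbN⟩ := exists_pos_le_of_ne_zero
    (g := fun n => √n * (sumProb p n (n - 1)).toReal) (fun n => by positivity) N
  refine ⟨min b (d / (2 * Real.pi) * (G / 2)), by positivity, fun n hn hne => ?_⟩
  have hn' : (0 : ℝ) < n := by exact_mod_cast hn
  rcases lt_or_ge n N with h | h
  · refine (min_le_left _ _).trans (hbN n h (mul_ne_zero (Real.sqrt_pos.2 hn').ne' ?_))
    exact (ENNReal.toReal_pos hne (sumProb_ne_top hp _ _)).ne'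
  · refine (min_le_right _ _).trans ?_
    have := hN n h
    simp only [Function.comp_apply] at this
    rw [integral_rescaledIntegrand hp hd hdvd hn (dvd_of_sumProb_ne_zero hdvd hne),
      Complex.ofReal_re] at this
    calc d / (2 * Real.pi) * (G / 2)
        ≤ d / (2 * Real.pi) * (2 * Real.pi / d * (√n * (sumProb p n (n - 1)).toReal)) := by gcongr
      _ = √n * (sumProb p n (n - 1)).toReal := by field_simp

end PlaneTree

namespace PlaneTree

theorem tsum_factorial_moment_le (p : ℕ → ℝ≥0∞) :
    ∑' j : ℕ, (((j + 2) * (j + 1) : ℕ) : ℝ≥0∞) * p (j + 2) ≤ 2 * xiVar p := by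
  rw [xiVar, ← ENNReal.tsum_mul_left]
  refine le_trans (ENNReal.tsum_le_tsum fun j => ?_)
    (ENNReal.tsum_comp_le_tsum_of_injective (add_left_injective 2) _)
  have h : ((((j + 2 : ℕ) : ℝ)) - 1) ^ 2 = (((j + 1) ^ 2 : ℕ) : ℝ) := by
    push_cast
    ring
  rw [h, ENNReal.ofReal_natCast, mul_comm (p (j + 2)), ← mul_assoc]
  gcongr
  exact_mod_cast (by nlinarith : (j + 2) * (j + 1) ≤ 2 * (j + 1) ^ 2)

theorem sumProb_le_of_two_mul_le {p : ℕ → ℝ≥0∞} (hp : ∑' k, p k = 1) {A : ℝ} (hA : 0 ≤ A)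
    (hupper : ∀ m, 1 ≤ m → ∀ s, (sumProb p m s).toReal ≤ A / √m) {n m : ℕ} (hn : 1 ≤ n)
    (hm : n ≤ 2 * m) (s : ℕ) : sumProb p m s ≤ ENNReal.ofReal (A * √2 / √n) := by
  rw [← ENNReal.ofReal_toReal (sumProb_ne_top hp m s)]
  have hm1 : 1 ≤ m := by omega
  have hm' : (0 : ℝ) < m := by exact_mod_cast hm1
  have hn' : (0 : ℝ) < n := by exact_mod_cast hn
  refine ENNReal.ofReal_le_ofReal ((hupper m hm1 s).trans ?_)
  rw [div_le_div_iff₀ (Real.sqrt_pos.2 hm') (Real.sqrt_pos.2 hn'), mul_assoc,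
    ← Real.sqrt_mul zero_le_two]
  gcongr
  exact_mod_cast hm

end PlaneTree

open PlaneTree

/-- Theorem 6 of Devroye–Janson.  `E Q_k(T̂_n) ≤ C k` uniformly in
`k, n ≥ 1`, where `T̂_n` is the subtree of `T_n` rooted at a uniformly random vertex
`u` of `T_n`; `Q_k` of that subtree is the number of pairs of vertices of `T_n` at
distance `k` whose last common ancestor is `u`. -/
theorem expected_rootPairCount_fringe_le
    (p : ℕ → ℝ≥0∞) (hp : ∑' k : ℕ, p k = 1)
    (hmean : ∑' k : ℕ, (k : ℝ≥0∞) * p k = 1)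
    (hvar_pos : 0 < xiVar p) (hvar_fin : xiVar p ≠ ⊤) :
    ∃ C : ℝ, 0 < C ∧ ∀ k n : ℕ, 1 ≤ k → 1 ≤ n → probSize p n ≠ 0 →
      condExp p n (fun t => ∑ᶠ u ∈ PlaneTree.vertexSet t, (pairCountThrough t u k : ℝ≥0∞)) / n
        ≤ ENNReal.ofReal (C * k) := by
  obtain ⟨d, hd, hdvd, c, hc, hdecay⟩ := exists_span_and_decay hp hmean hvar_pos
  obtain ⟨b, hb, hlower⟩ :=
    exists_le_sqrt_mul_sumProb hp hmean hvar_pos hvar_fin hd hdvd hc hdecay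
  have hupper : ∀ m, 1 ≤ m → ∀ s, (sumProb p m s).toReal ≤
      d / (2 * Real.pi) * √(Real.pi / c) / √m := fun m hm s =>
    toReal_sumProb_le hp hd hdvd hc hdecay hm s
  set A := d / (2 * Real.pi) * √(Real.pi / c)
  have hA : 0 ≤ A := by
    have := Real.pi_pos
    positivity
  set V := ∑' j : ℕ, (((j + 2) * (j + 1) : ℕ) : ℝ≥0∞) * p (j + 2) with hVdef
  have hV : V ≠ ⊤ := ne_top_of_le_ne_top (by finiteness) (tsum_factorial_moment_le p)
  set D := (1 + V.toReal) * (A * √2) / b with hDdef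
  have hD : 0 ≤ D := by positivity
  refine ⟨2 + D, by positivity, fun k n hk hn hP => ?_⟩
  have hk' : (1 : ℝ) ≤ k := by exact_mod_cast hk
  have hn' : (0 : ℝ) < n := by exact_mod_cast hn
  have hS := mul_probSize p hn
  have hStop := sumProb_ne_top hp n (n - 1)
  have hS0 : sumProb p n (n - 1) ≠ 0 := by
    rw [← hS]
    exact mul_ne_zero (by exact_mod_cast (by omega : n ≠ 0)) hP
  refine ENNReal.div_le_of_le_mul (ENNReal.div_le_of_le_mul ?_)
  rw [mul_assoc, hS]
  rcases le_or_gt (2 * k) n with hkn | hkn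
  · refine (tsum_pairCount_le hmean hk (by omega)
      (sumProb_le_of_two_mul_le hp hA hupper hn (by omega))
      (sumProb_le_of_two_mul_le hp hA hupper hn (by omega))).trans ?_
    rw [← hVdef, ← ENNReal.ofReal_toReal hStop, ← ENNReal.ofReal_mul (by positivity),
      ← ENNReal.ofReal_toReal hV, ← ENNReal.ofReal_natCast k, ← ENNReal.ofReal_one,
      ← ENNReal.ofReal_mul (by positivity), ← ENNReal.ofReal_add (by positivity) (by positivity),
      ← ENNReal.ofReal_mul (by positivity)]
    refine ENNReal.ofReal_le_ofReal ?_
    have hlow : b / √n ≤ (sumProb p n (n - 1)).toReal :=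
      (div_le_iff₀' (Real.sqrt_pos.2 hn')).2 (hlower n hn hS0)
    calc (1 + k * V.toReal) * (A * √2 / √n)
        ≤ (k * (1 + V.toReal)) * (A * √2 / √n) := by
          gcongr
          linarith
      _ = D * k * (b / √n) := by
          rw [hDdef]
          field_simp
      _ ≤ (2 + D) * k * (sumProb p n (n - 1)).toReal := by
          gcongr
          linarith
  · calc (∑' t, if size t = n then
          gwProb p t * ∑ᶠ u ∈ PlaneTree.vertexSet t, (pairCountThrough t u k : ℝ≥0∞) else 0)
        ≤ ∑' t, (n : ℝ≥0∞) ^ 2 * (if size t = n then gwProb p t else 0) := by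
          refine ENNReal.tsum_le_tsum fun t => ?_
          split_ifs with ht
          · rw [mul_comm, ← ht]
            gcongr
            exact finsum_pairCountThrough_le_sq t k
          · exact zero_le
      _ = n * sumProb p n (n - 1) := by
          rw [ENNReal.tsum_mul_left, ← probSize, ← hS]
          ring
      _ ≤ ENNReal.ofReal ((2 + D) * k) * sumProb p n (n - 1) := by
          gcongr
          rw [← ENNReal.ofReal_natCast]
          refine ENNReal.ofReal_le_ofReal ?_
          have : (n : ℝ) ≤ 2 * k := by exact_mod_cast hkn.le
          nlinarith
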